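/- arXiv:2512.10190 — 11 statements merged into one kernel-verified Lean document; each statement's English description precedes it below -/
import Mathlib

section
/- Let r ≥ 2 be an integer. Every K_{r+1}-free simple graph G on n vertices with minimum degree δ(G) > ((3r-4)/(3r-1))·n is r-partite. -/
/-- **Andrásfai–Erdős–Sós theorem.** Let `r ≥ 2`. Every `K_{r+1}`-free simple graph on `n`
vertices with minimum degree greater than `((3r-4)/(3r-1)) * n` is `r`-partite. -/
theorem stmt_0 {V : Type*} [Fintype V] (r : ℕ) (hr : 2 ≤ r)
    (G : SimpleGraph V) [DecidableRel G.Adj]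
    (hfree : G.CliqueFree (r + 1))
    (hdeg : (G.minDegree : ℝ) >
      (3 * (r : ℝ) - 4) / (3 * (r : ℝ) - 1) * (Fintype.card V : ℝ)) :
    G.Colorable r := by
  have hr' : (2 : ℝ) ≤ r := by exact_mod_cast hr
  refine SimpleGraph.colorable_of_cliqueFree_lt_minDegree hfree ?_
  rw [Nat.div_lt_iff_lt_mul (by lia)]
  rw [gt_iff_lt, div_mul_eq_mul_div, div_lt_iff₀ (by linarith)] at hdeg
  have h4 : ((3 * r - 4 : ℕ) : ℝ) = 3 * r - 4 := by
    rw [Nat.cast_sub (by lia)]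
    push_cast
    rfl
  have h1 : ((3 * r - 1 : ℕ) : ℝ) = 3 * r - 1 := by
    rw [Nat.cast_sub (by lia)]
    push_cast
    rfl
  rw [← h4, ← h1] at hdeg
  exact_mod_cast hdeg
end

section
/- Let r ≥ 2 be an integer. Suppose G is an n-vertex K_{r+1}-free simple graph satisfying δ(G) > min{ ((3r-4)/(3r-2))·n − Δ(G)/(3r-2), n − (Δ(G)+1)/(r-1) }. Then G is r-partite. -/
namespace SimpleGraph

open Finset

section CommonNeighbours

variable {V : Type*} [Fintype V] [DecidableEq V] {G : SimpleGraph V} [DecidableRel G.Adj]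

/-- A clique whose common neighbourhood contains a set of more than `j * d` vertices, where every
vertex has at most `d` non-neighbours, extends to a clique with `j + 1` more vertices. -/
lemma not_cliqueFree_of_mul_lt_card_common {d : ℕ}
    (hd : ∀ x, #{y | ¬ G.Adj x y} ≤ d) {i j : ℕ} {K N : Finset V} (hK : G.IsNClique i K)
    (hN : ∀ x ∈ N, ∀ y ∈ K, G.Adj x y) (hcard : j * d < #N) : ¬ G.CliqueFree (i + j + 1) := by
  induction j generalizing i K N with
  | zero =>
    obtain ⟨x, hx⟩ := card_pos.1 (by simpa using hcard)
    exact (hK.insert (hN x hx)).not_cliqueFree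
  | succ j ih =>
    obtain ⟨x, hx⟩ := card_pos.1 (pos_of_gt hcard)
    have hsub : #N ≤ #{y ∈ N | G.Adj x y} + d := by
      rw [← card_filter_add_card_filter_not (s := N) (G.Adj x)]
      gcongr
      exact (card_le_card (filter_subset_filter _ (subset_univ N))).trans (hd x)
    have := ih (K := insert x K) (N := {y ∈ N | G.Adj x y}) (hK.insert (hN x hx))
      (by simp only [mem_filter, mem_insert]; rintro y ⟨hy, hxy⟩ z (rfl | hz)
          exacts [hxy.symm, hN y hy z hz]) (by linarith [add_mul j 1 d])
    rwa [show i + 1 + j + 1 = i + (j + 1) + 1 by ring] at this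

/-- In a `K_{m+3}`-free graph in which every vertex has at most `d` non-neighbours, if some vertex
has degree at least `(m + 1) * d` then the graph is complete multipartite. -/
lemma isCompleteMultipartite_of_mul_le_degree {d m : ℕ} (hf : G.CliqueFree (m + 3))
    (hd : ∀ x, #{y | ¬ G.Adj x y} ≤ d) (v : V) (hv : (m + 1) * d ≤ G.degree v) :
    G.IsCompleteMultipartite := by
  have hmem (x : V) : x ∈ ({y | ¬ G.Adj x y} : Finset V) := by simp
  have hdpos : 0 < d := (card_pos.2 ⟨v, hmem v⟩).trans_le (hd v)
  have hin {w u : V} (hw : G.Adj v w) (hwu : ¬ G.Adj w u) : G.Adj v u := by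
    by_contra hu
    have h1 : #(G.neighborFinset v) ≤ #{y ∈ G.neighborFinset v | G.Adj w y} + (d - 1) := by
      rw [← card_filter_add_card_filter_not (s := G.neighborFinset v) (G.Adj w)]
      gcongr
      refine (card_le_card ?_).trans
        ((card_erase_of_mem (by simpa using hwu : u ∈ ({y | ¬ G.Adj w y} : Finset V))).trans_le
          (Nat.sub_le_sub_right (hd w) 1))
      intro y
      simp only [mem_filter, mem_neighborFinset, mem_erase, mem_univ, true_and]
      exact fun ⟨hy, hwy⟩ ↦ ⟨fun h ↦ hu (h ▸ hy), hwy⟩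
    refine not_cliqueFree_of_mul_lt_card_common (G := G) hd (i := 2) (j := m) (K := {v, w})
      (N := {y ∈ G.neighborFinset v | G.Adj w y}) ?_ ?_ ?_ (by convert hf using 1; ring)
    · exact ⟨by simp [isClique_iff, Set.pairwise_insert, hw, G.adj_comm],
        card_pair hw.ne⟩
    · simp +contextual [G.adj_comm]
    · rw [card_neighborFinset_eq_degree] at h1
      have := add_mul m 1 d
      lia
  have hout {x y : V} (hx : ¬ G.Adj v x) (hy : ¬ G.Adj v y) : ¬ G.Adj x y := by
    intro hxy
    refine not_cliqueFree_of_mul_lt_card_common (G := G) hd (i := 2) (j := m) (K := {x, y})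
      (N := G.neighborFinset v) ?_ ?_ ?_ (by convert hf using 1; ring)
    · exact ⟨by simp [isClique_iff, Set.pairwise_insert, hxy, G.adj_comm],
        card_pair hxy.ne⟩
    · simp only [mem_neighborFinset, mem_insert, mem_singleton]
      rintro z hz _ (rfl | rfl) <;> by_contra h
      exacts [hx (hin hz h), hy (hin hz h)]
    · rw [card_neighborFinset_eq_degree]
      have := add_mul m 1 d
      lia
  refine ⟨fun a b c hab hbc hac ↦ ?_⟩
  by_cases hb : G.Adj v b
  · have hba : ¬ G.Adj b a := fun h ↦ hab h.symm
    have ha := hin hb hba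
    have hc := hin hb hbc
    have htri : G.IsNClique 3 {v, a, c} := is3Clique_triple_iff.2 ⟨ha, hc, hac⟩
    obtain _ | m := m
    · exact htri.not_cliqueFree hf
    have h1 : #(G.neighborFinset v) <
        #{y ∈ G.neighborFinset v | G.Adj a y ∧ G.Adj c y} + 2 * d := by
      rw [← card_filter_add_card_filter_not (s := G.neighborFinset v)
        (fun y ↦ G.Adj a y ∧ G.Adj c y)]
      gcongr
      have hsub : #{y ∈ G.neighborFinset v | ¬ (G.Adj a y ∧ G.Adj c y)} ≤
          #(({y | ¬ G.Adj a y} : Finset V) ∪ ({y | ¬ G.Adj c y} : Finset V)) := by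
        refine card_le_card fun y ↦ ?_
        simp only [mem_filter, mem_union, mem_univ, true_and]
        tauto
      have hb : 0 < #(({y | ¬ G.Adj a y} : Finset V) ∩ ({y | ¬ G.Adj c y} : Finset V)) :=
        card_pos.2 ⟨b, by simpa using ⟨hab, fun h ↦ hbc h.symm⟩⟩
      have := card_union_add_card_inter ({y | ¬ G.Adj a y} : Finset V)
        ({y | ¬ G.Adj c y} : Finset V)
      linarith [hd a, hd c]
    refine not_cliqueFree_of_mul_lt_card_common (G := G) hd (j := m) htri
      (N := {y ∈ G.neighborFinset v | G.Adj a y ∧ G.Adj c y}) ?_ ?_ (by convert hf using 1; ring)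
    · simp +contextual [G.adj_comm]
    · rw [card_neighborFinset_eq_degree] at h1
      have : (m + 1 + 1) * d = m * d + 2 * d := by ring
      lia
  · exact hout (fun h ↦ hb (hin h hab)) (fun h ↦ hb (hin h fun h' ↦ hbc h'.symm)) hac

end CommonNeighbours
section Wheel

variable {V : Type*} [Fintype V] [DecidableEq V] {G : SimpleGraph V} [DecidableRel G.Adj]

/-- Lower bounds on the number of non-neighbours in `W` of the vertices of `X` and of `Xᶜ` give an
upper bound on the degree sum over `W`. -/
lemma sum_degree_le_of_forall_le_card_not_adj {W X : Finset V} {i j : ℕ}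
    (hx : ∀ x ∈ X, i ≤ #{z ∈ W | ¬ G.Adj x z}) (hxc : ∀ y ∈ Xᶜ, j ≤ #{z ∈ W | ¬ G.Adj y z}) :
    ∑ w ∈ W, G.degree w ≤ #X * (#W - i) + #Xᶜ * (#W - j) := calc
  _ = ∑ v, #(G.neighborFinset v ∩ W) := by
    simp_rw [degree, card_eq_sum_ones]
    exact sum_comm' (by simp [and_comm, adj_comm])
  _ ≤ _ := by
    simp_rw [← union_compl X, sum_union disjoint_compl_right (s₁ := X), neighborFinset_eq_filter,
             filter_inter, univ_inter, card_eq_sum_ones X, card_eq_sum_ones Xᶜ, sum_mul, one_mul]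
    gcongr <;> grind [card_filter_add_card_filter_not]

/-- In a `Kᵣ₊₂`-free graph, a five-wheel-like structure that is maximal among those with the same
apex `v` and rim edge `w₁w₂` bounds the degree of `v` in terms of the minimum degree. -/
lemma IsFiveWheelLike.degree_add_mul_minDegree_le {r k : ℕ} {v w₁ w₂ : V} {s t : Finset V}
    (hw : G.IsFiveWheelLike r k v w₁ w₂ s t) (hcf : G.CliqueFree (r + 2))
    (hm : ∀ s' t', ¬ G.IsFiveWheelLike r (k + 1) v w₁ w₂ s' t') :
    G.degree v + (2 * r + k + 2) * G.minDegree ≤ (2 * r + k) * Fintype.card V := by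
  let X : Finset V := {x | ∀ ⦃y⦄, y ∈ s ∩ t → G.Adj x y}
  let W := {v} ∪ ({w₁} ∪ ({w₂} ∪ (s ∪ t)))
  have three_le : ∀ x ∈ X, 3 ≤ #{z ∈ W | ¬ G.Adj x z} := by
    intro x hx
    by_contra! h
    obtain ⟨_, _, hW⟩ := hw.exists_isFiveWheelLike_succ_of_not_adj_le_two hcf
      (by simpa [X] using hx) <| Nat.le_of_succ_le_succ h
    exact hm _ _ hW
  have one_le (x : V) : 1 ≤ #{z ∈ W | ¬ G.Adj x z} :=
    let ⟨_, hz⟩ := hw.isNClique_fst_left.exists_not_adj_of_cliqueFree_succ hcf x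
    card_pos.2 ⟨_, mem_filter.2 ⟨by grind, hz.2⟩⟩
  have sum_W := sum_degree_le_of_forall_le_card_not_adj three_le (fun y _ ↦ one_le y)
  have one_le_inter : ∀ x ∈ Xᶜ, 1 ≤ #{z ∈ s ∩ t | ¬ G.Adj x z} := by
    intro x hx
    obtain ⟨y, hy⟩ : ∃ y ∈ s ∩ t, ¬ G.Adj x y := by
      contrapose! hx
      simpa [X] using hx
    exact card_pos.2 ⟨y, mem_filter.2 hy⟩
  have sum_inter := sum_degree_le_of_forall_le_card_not_adj one_le_inter (fun _ _ ↦ Nat.zero_le _)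
  rw [compl_compl, tsub_zero, hw.card_inter] at sum_inter
  have card_W : #W + k = 2 * r + 3 := by grind
  have hkr : k ≤ r := (hw.card_inter_lt_of_cliqueFree hcf).le
  have hX : #X + #Xᶜ = Fintype.card V := card_add_card_compl X
  have hvW : v ∈ W := by simp [W]
  have lower_W : G.degree v + (#W - 1) * G.minDegree ≤ ∑ w ∈ W, G.degree w := by
    rw [← add_sum_erase _ _ hvW, ← card_erase_of_mem hvW]
    gcongr
    exact card_nsmul_le_sum _ _ _ fun x _ ↦ G.minDegree_le_degree x
  have lower_inter : k * G.minDegree ≤ ∑ w ∈ s ∩ t, G.degree w := by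
    rw [← hw.card_inter]
    exact card_nsmul_le_sum _ _ _ fun x _ ↦ G.minDegree_le_degree x
  have hXc : k = 0 → #Xᶜ = 0 := by
    intro hk
    rw [← hw.card_inter, card_eq_zero] at hk
    simp [X, hk]
  obtain ⟨a, ha⟩ : ∃ a, #W = a + 3 := ⟨2 * r - k, by lia⟩
  have ha' : a + k = 2 * r := by lia
  rw [ha] at sum_W lower_W
  simp only [Nat.add_sub_cancel, show a + 3 - 1 = a + 2 by lia] at sum_W lower_W
  rw [← hX, ← ha']
  obtain rfl | ⟨l, rfl⟩ : k = 0 ∨ ∃ l, k = l + 1 := by cases k <;> simp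
  · simp only [hXc rfl] at *
    lia
  · simp only [Nat.add_sub_cancel] at sum_inter
    linarith

/-- In a maximal `Kᵣ₊₂`-free graph, if the non-neighbours of `v` span an edge then
`deg v + (3r + 1) δ ≤ (3r - 1) n`. -/
lemma degree_add_mul_minDegree_le_of_isPathGraph3Compl {r : ℕ}
    (h : Maximal (fun H ↦ H.CliqueFree (r + 2)) G) {v w₁ w₂ : V}
    (hp : G.IsPathGraph3Compl v w₁ w₂) :
    G.degree v + (3 * r + 1) * G.minDegree ≤ (3 * r - 1) * Fintype.card V := by
  obtain ⟨s, h1, h2, h3, h4⟩ := exists_of_maximal_cliqueFree_not_adj h hp.ne_fst hp.not_adj_fst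
  obtain ⟨t, h5, h6, h7, h8⟩ := exists_of_maximal_cliqueFree_not_adj h hp.ne_snd hp.not_adj_snd
  let P : ℕ → Prop := fun k ↦ ∃ s t, G.IsFiveWheelLike r k v w₁ w₂ s t
  have hw : G.IsFiveWheelLike r #(s ∩ t) v w₁ w₂ s t := ⟨hp, h1, h5, h2, h6, h3, h4, h7, h8, rfl⟩
  have hlt {k : ℕ} : P k → k < r := fun ⟨_, _, hk⟩ ↦ hk.card_inter_lt_of_cliqueFree h.1
  classical
  have hP : P (Nat.findGreatest P r) := Nat.findGreatest_spec (hlt ⟨s, t, hw⟩).le ⟨s, t, hw⟩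
  have hkr := hlt hP
  obtain ⟨s', t', hw'⟩ := hP
  have key := hw'.degree_add_mul_minDegree_le h.1 fun s₁ t₁ h₁ ↦
    (Nat.lt_succ_self _).not_ge (Nat.le_findGreatest (hlt ⟨s₁, t₁, h₁⟩).le ⟨s₁, t₁, h₁⟩)
  generalize Nat.findGreatest P r = k at hkr key
  have : Nonempty V := ⟨v⟩
  have hδ := G.minDegree_lt_card.le
  obtain ⟨l, rfl⟩ : ∃ l, r = k + 1 + l := ⟨r - (k + 1), by lia⟩
  have := Nat.mul_le_mul_left l hδ
  rw [show 3 * (k + 1 + l) - 1 = 2 * (k + 1 + l) + k + l by lia]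
  linarith

end Wheel

section Neighbours

variable {V : Type*} {G : SimpleGraph V}

lemma CliqueFree.induce_neighborSet {n : ℕ} (h : G.CliqueFree (n + 1)) (v : V) :
    (G.induce (G.neighborSet v)).CliqueFree n := by
  classical
  intro s hs
  refine (IsNClique.insert (a := v) ((hs.map (f := .subtype _)).mono (G.map_comap_le _))
    fun b hb ↦ ?_).not_cliqueFree h
  obtain ⟨x, -, rfl⟩ := mem_map.1 hb
  exact x.2

/-- If the complement of `s` is independent then one colour more than is needed for `s` is enough
for the whole graph. -/
lemma Colorable.succ_of_induce {n : ℕ} {s : Set V} (h : (G.induce s).Colorable n)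
    (hs : ∀ x ∉ s, ∀ y ∉ s, ¬ G.Adj x y) : G.Colorable (n + 1) := by
  classical
  obtain ⟨C⟩ := h
  have := (Coloring.mk (G := G)
    (fun x ↦ if hx : x ∈ s then some (C ⟨x, hx⟩) else none) (by
      intro x y hxy
      by_cases hx : x ∈ s <;> by_cases hy : y ∈ s
      · simpa [hx, hy] using C.valid (v := ⟨x, hx⟩) (w := ⟨y, hy⟩) hxy
      · simp [hx, hy]
      · simp [hx, hy]
      · exact absurd hxy (hs x hx y hy))).colorable
  simpa using this

lemma degree_le_degree_induce_neighborSet_add [Fintype V] [DecidableEq V] [DecidableRel G.Adj]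
    (v : V) (u : G.neighborSet v) :
    G.degree u ≤ (G.induce (G.neighborSet v)).degree u + (Fintype.card V - G.degree v) := by
  rw [← card_neighborFinset_eq_degree G v, ← card_compl, ← card_neighborFinset_eq_degree,
    ← card_neighborFinset_eq_degree, ← card_map (.subtype (· ∈ G.neighborSet v))]
  refine (card_le_card fun x hx ↦ ?_).trans (card_union_le _ _)
  by_cases h : G.Adj v x <;> simp_all

variable [Fintype V] [DecidableRel G.Adj]

/-- If the non-neighbours of a vertex `v` of a `K_{m+3}`-free graph are independent and the minimum
degree is large in terms of `deg v`, then the graph is `(m + 2)`-colorable. -/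
lemma colorable_of_isIndep_not_adj {m : ℕ} (hf : G.CliqueFree (m + 3)) {v : V}
    (hv : ∀ x y, ¬ G.Adj v x → ¬ G.Adj v y → ¬ G.Adj x y)
    (hd : (3 * m + 2) * Fintype.card V < (3 * m + 4) * G.minDegree + G.degree v) :
    G.Colorable (m + 2) := by
  classical
  refine Colorable.succ_of_induce (s := G.neighborSet v) ?_ fun x hx y hy ↦ hv x y hx hy
  have hf' := hf.induce_neighborSet v
  obtain _ | m := m
  · exact colorable_one_iff.2 (cliqueFree_two.1 hf')
  · refine colorable_of_cliqueFree_lt_minDegree hf' ?_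
    have hδv := G.minDegree_le_degree v
    have hvn : G.degree v < Fintype.card V := G.degree_lt_card_verts v
    obtain ⟨u₀, hu₀⟩ := (G.degree_pos_iff_exists_adj v).1 (by
      by_contra! h0
      have h1 : G.degree v = 0 := by lia
      have h2 : G.minDegree = 0 := by lia
      simp [h1, h2] at hd)
    have : Nonempty (G.neighborSet v) := ⟨⟨u₀, hu₀⟩⟩
    have hδ' : G.minDegree - (Fintype.card V - G.degree v) ≤
        (G.induce (G.neighborSet v)).minDegree :=
      le_minDegree_of_forall_le_degree _ _ fun u ↦ by
        have := degree_le_degree_induce_neighborSet_add v u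
        have := G.minDegree_le_degree u
        lia
    rw [Nat.div_lt_iff_lt_mul (by lia), card_neighborSet_eq_degree]
    obtain ⟨e, he⟩ : ∃ e, Fintype.card V = G.degree v + e := ⟨_, (Nat.add_sub_of_le hvn.le).symm⟩
    rw [show 3 * (m + 1 + 1) - 4 = 3 * m + 2 by lia, show 3 * (m + 1 + 1) - 1 = 3 * m + 5 by lia]
    have hδ'' : G.minDegree ≤ (G.induce (G.neighborSet v)).minDegree + e := by lia
    have := Nat.mul_le_mul_left (3 * m + 5) hδ''
    rw [he] at hd
    linarith

end Neighbours

/-- Strengthening of the **Andrásfai-Erdős-Sós** theorem in terms of the maximum degree. -/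
theorem colorable_of_lt_mul_minDegree_add_maxDegree {V : Type*} [Fintype V]
    {G : SimpleGraph V} [DecidableRel G.Adj] {m : ℕ} (hf : G.CliqueFree (m + 3))
    (hd : (3 * m + 2) * Fintype.card V < (3 * m + 4) * G.minDegree + G.maxDegree) :
    G.Colorable (m + 2) := by
  classical
  obtain ⟨H, hle, hH⟩ := @Finite.exists_le_maximal _ _ _ (fun H ↦ H.CliqueFree (m + 3)) G hf
  refine Colorable.mono_left hle ?_
  cases isEmpty_or_nonempty V
  · exact .of_isEmpty _
  obtain ⟨v, hv⟩ := H.exists_maximal_degree_vertex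
  have hδ := minDegree_le_minDegree hle
  have hΔ := maxDegree_mono hle
  replace hd : (3 * m + 2) * Fintype.card V < (3 * m + 4) * H.minDegree + H.degree v :=
    hd.trans_le (by rw [← hv]; gcongr)
  refine colorable_of_isIndep_not_adj hH.1 (fun x y hx hy hxy ↦ ?_) hd
  have := degree_add_mul_minDegree_le_of_isPathGraph3Compl (r := m + 1) hH ⟨hxy, hx, hy⟩
  rw [show 3 * (m + 1) - 1 = 3 * m + 2 by lia] at this
  linarith

/-- A `K_{m+3}`-free graph in which `(m + 1) (n - δ) ≤ Δ` is `(m + 2)`-colorable. -/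
theorem colorable_of_mul_le_maxDegree {V : Type*} [Fintype V]
    {G : SimpleGraph V} [DecidableRel G.Adj] {m : ℕ} (hf : G.CliqueFree (m + 3))
    (hd : (m + 1) * (Fintype.card V - G.minDegree) ≤ G.maxDegree) : G.Colorable (m + 2) := by
  classical
  cases isEmpty_or_nonempty V
  · exact .of_isEmpty _
  obtain ⟨v, hv⟩ := G.exists_maximal_degree_vertex
  refine (isCompleteMultipartite_of_mul_le_degree hf (fun x ↦ ?_) v
    (hv ▸ hd)).colorable_of_cliqueFree hf
  have h1 := card_filter_add_card_filter_not (s := (univ : Finset V)) (G.Adj x)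
  rw [← neighborFinset_eq_filter, card_neighborFinset_eq_degree, card_univ] at h1
  have := G.minDegree_le_degree x
  lia

end SimpleGraph

/-- Let `r ≥ 2`. If `G` is an `n`-vertex `K_{r+1}`-free simple graph with
`δ(G) > min{ ((3r-4)/(3r-2))·n − Δ(G)/(3r-2), n − (Δ(G)+1)/(r-1) }`, then `G` is
`r`-partite. -/
theorem stmt_2 {V : Type*} [Fintype V] (r : ℕ) (hr : 2 ≤ r)
    (G : SimpleGraph V) [DecidableRel G.Adj]
    (hfree : G.CliqueFree (r + 1))
    (hdeg : (G.minDegree : ℝ) >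
      min ((3 * (r : ℝ) - 4) / (3 * (r : ℝ) - 2) * (Fintype.card V : ℝ)
            - (G.maxDegree : ℝ) / (3 * (r : ℝ) - 2))
          ((Fintype.card V : ℝ) - ((G.maxDegree : ℝ) + 1) / ((r : ℝ) - 1))) :
    G.Colorable r := by
  obtain ⟨m, rfl⟩ : ∃ m, r = m + 2 := ⟨r - 2, by lia⟩
  have hm : (0 : ℝ) ≤ m := m.cast_nonneg
  push_cast at hdeg
  rcases min_lt_iff.1 hdeg with h | h
  · refine SimpleGraph.colorable_of_lt_mul_minDegree_add_maxDegree hfree ?_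
    rw [div_mul_eq_mul_div, ← sub_div, div_lt_iff₀ (by linarith)] at h
    rify
    linarith
  · refine SimpleGraph.colorable_of_mul_le_maxDegree hfree ?_
    rw [sub_lt_comm, lt_div_iff₀ (by linarith)] at h
    have hδ : G.minDegree ≤ Fintype.card V := by
      cases isEmpty_or_nonempty V
      · simp [SimpleGraph.minDegree_of_subsingleton]
      · exact G.minDegree_lt_card.le
    rw [← Nat.lt_add_one_iff]
    rify [hδ]
    linarith
end

section
/- Let r ≥ 2 be an integer. Suppose G is an n-vertex K_{r+1}-free simple graph satisfying (r-1)·δ(G) + Δ(G) ≥ (r-1)·n (equivalently, δ(G) > n − (Δ(G)+1)/(r-1)). Then G is r-partite. -/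
/-- Greedy clique extension: if every vertex has at most `d` non-neighbours, then a clique `T`
completely joined to a set of more than `k * d` vertices extends by `k + 1` vertices. -/
theorem SimpleGraph.not_cliqueFree_of_card_lt_of_forall_adj {V : Type*} [Fintype V] [DecidableEq V]
    (G : SimpleGraph V) [DecidableRel G.Adj] {d : ℕ}
    (hd : ∀ x, (Finset.univ.filter fun y => ¬ G.Adj x y).card ≤ d) (k : ℕ) {t : ℕ}
    (T A : Finset V) (hT : G.IsNClique t T) (hTA : ∀ x ∈ A, ∀ y ∈ T, G.Adj x y)
    (hA : k * d < A.card) : ¬ G.CliqueFree (t + (k + 1)) := by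
  induction k generalizing t T A with
  | zero =>
    obtain ⟨x, hx⟩ := Finset.card_pos.mp (by omega : 0 < A.card)
    exact (hT.insert (hTA x hx)).not_cliqueFree
  | succ k ih =>
    obtain ⟨x, hx⟩ := Finset.card_pos.mp (by omega : 0 < A.card)
    have hsplit := Finset.card_filter_add_card_filter_not (s := A) (G.Adj x)
    have hle : (A.filter fun y => ¬ G.Adj x y).card ≤ d :=
      (Finset.card_le_card (Finset.filter_subset_filter _ (Finset.subset_univ A))).trans (hd x)
    have := ih (insert x T) (A.filter (G.Adj x)) (hT.insert (hTA x hx)) (by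
      intro y hy z hz
      obtain ⟨hyA, hxy⟩ := Finset.mem_filter.mp hy
      rcases Finset.mem_insert.mp hz with rfl | hz
      · exact hxy.symm
      · exact hTA y hyA z hz) (by
      rw [Nat.succ_mul] at hA
      omega)
    rwa [show t + 1 + (k + 1) = t + (k + 1 + 1) by omega] at this

/-- Let `r ≥ 2`. If `G` is an `n`-vertex `K_{r+1}`-free simple graph with
`(r-1)·δ(G) + Δ(G) ≥ (r-1)·n`, then `G` is `r`-partite. -/
theorem stmt_3 {V : Type*} [Fintype V] (r : ℕ) (hr : 2 ≤ r)
    (G : SimpleGraph V) [DecidableRel G.Adj]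
    (hfree : G.CliqueFree (r + 1))
    (hdeg : (r - 1) * Fintype.card V ≤ (r - 1) * G.minDegree + G.maxDegree) :
    G.Colorable r := by
  classical
  rcases isEmpty_or_nonempty V with hV | hV
  · exact SimpleGraph.Colorable.of_isEmpty r
  obtain ⟨v, hv⟩ := G.exists_maximal_degree_vertex
  obtain ⟨s, rfl⟩ := Nat.exists_eq_add_of_le' hr
  obtain ⟨d, hcard⟩ := Nat.exists_eq_add_of_le
    (show G.minDegree ≤ Fintype.card V from
      (G.minDegree_le_degree v).trans (G.degree_lt_card_verts v).le)
  have hd0 : 0 < d := by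
    have := (G.minDegree_le_degree v).trans_lt (G.degree_lt_card_verts v)
    omega
  have hN : s * d + d ≤ (G.neighborFinset v).card := by
    rw [G.card_neighborFinset_eq_degree, ← hv]
    rw [hcard, show s + 2 - 1 = s + 1 by omega, Nat.mul_add, Nat.succ_mul s d] at hdeg
    omega
  have hd : ∀ x, (Finset.univ.filter fun y => ¬ G.Adj x y).card ≤ d := by
    intro x
    have h1 := Finset.card_filter_add_card_filter_not (s := Finset.univ) (G.Adj x)
    rw [← G.neighborFinset_eq_filter, G.card_neighborFinset_eq_degree, Finset.card_univ] at h1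
    have := G.minDegree_le_degree x
    omega
  have hjoin : ∀ a b, G.Adj v a → ¬ G.Adj v b → G.Adj a b := by
    intro a b ha hb
    by_contra hab
    refine G.not_cliqueFree_of_card_lt_of_forall_adj hd s (t := 2) {a, v}
      ((G.neighborFinset v).filter (G.Adj a)) ?_ ?_ ?_ (by convert hfree using 1; omega)
    · simp [SimpleGraph.isNClique_iff, ha.symm, ha.ne']
    · simp +contextual [SimpleGraph.adj_comm]
    · have h1 := Finset.card_filter_add_card_filter_not (s := G.neighborFinset v) (G.Adj a)
      have h2 : ((G.neighborFinset v).filter fun y => ¬ G.Adj a y).card <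
          (Finset.univ.filter fun y => ¬ G.Adj a y).card := by
        apply Finset.card_lt_card
        rw [Finset.ssubset_iff]
        refine ⟨b, by simp [hb], ?_⟩
        intro y
        simp only [Finset.mem_insert, Finset.mem_filter, Finset.mem_univ, true_and]
        rintro (rfl | h)
        exacts [hab, h.2]
      have := hd a
      omega
  have hout : ∀ a c, ¬ G.Adj v a → ¬ G.Adj v c → ¬ G.Adj a c := by
    intro a c ha hc hac
    refine G.not_cliqueFree_of_card_lt_of_forall_adj hd s (t := 2) {a, c}
      (G.neighborFinset v) ?_ ?_ (by omega) (by convert hfree using 1; omega)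
    · simp [SimpleGraph.isNClique_iff, hac, hac.ne]
    · intro x hx y hy
      rw [SimpleGraph.mem_neighborFinset] at hx
      simp only [Finset.mem_insert, Finset.mem_singleton] at hy
      rcases hy with rfl | rfl
      exacts [hjoin _ _ hx ha, hjoin _ _ hx hc]
  have hin : ∀ a b c, G.Adj v a → G.Adj v c → ¬ G.Adj a b → ¬ G.Adj b c → ¬ G.Adj a c := by
    intro a b c ha hc hab hbc hac
    have hT : G.IsNClique 3 {a, c, v} :=
      SimpleGraph.is3Clique_triple_iff.mpr ⟨hac, ha.symm, hc.symm⟩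
    rcases s with _ | s
    · exact hT.not_cliqueFree hfree
    refine G.not_cliqueFree_of_card_lt_of_forall_adj hd s {a, c, v}
      ((G.neighborFinset v).filter fun y => G.Adj a y ∧ G.Adj c y) hT ?_ ?_
      (by convert hfree using 1; omega)
    · simp +contextual [SimpleGraph.adj_comm]
    · have h1 := Finset.card_filter_add_card_filter_not (s := G.neighborFinset v)
        (fun y => G.Adj a y ∧ G.Adj c y)
      have h2 : ((G.neighborFinset v).filter fun y => ¬ (G.Adj a y ∧ G.Adj c y)).card ≤
          ((Finset.univ.filter fun y => ¬ G.Adj a y) ∪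
            (Finset.univ.filter fun y => ¬ G.Adj c y)).card := by
        apply Finset.card_le_card
        intro y
        simp only [Finset.mem_union, Finset.mem_filter, Finset.mem_univ, true_and]
        tauto
      have h3 := Finset.card_union_add_card_inter (Finset.univ.filter fun y => ¬ G.Adj a y)
        (Finset.univ.filter fun y => ¬ G.Adj c y)
      have h4 : 0 < ((Finset.univ.filter fun y => ¬ G.Adj a y) ∩
            (Finset.univ.filter fun y => ¬ G.Adj c y)).card :=
        Finset.card_pos.mpr ⟨b, by simp [hab, G.adj_comm c b, hbc]⟩
      have := hd a
      have := hd c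
      rw [Nat.succ_mul] at hN
      omega
  have hmulti : G.IsCompleteMultipartite := by
    refine ⟨fun a b c hab hbc => ?_⟩
    by_cases ha : G.Adj v a <;> by_cases hc : G.Adj v c
    · exact hin a b c ha hc hab hbc
    · exact absurd (hjoin a b ha fun hb => hbc (hjoin b c hb hc)) hab
    · exact absurd (hjoin c b hc fun hb => hab (hjoin b a hb ha).symm).symm hbc
    · exact hout a c ha hc
  exact hmulti.colorable_of_cliqueFree hfree
end

section
/- Let k ≥ 2 be an integer. Suppose G is an n-vertex C_{≤2k+1}-free simple graph satisfying δ(G) > min{ n/(k+1) − Δ(G)/(2k+2), (n − 1 − Δ(G))/k }. Then G is bipartite. -/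
namespace SimpleGraph

variable {V : Type*} {G : SimpleGraph V}

/-- An odd closed walk of minimal length among all odd closed walks is a cycle. -/
lemma Walk.isCycle_of_odd_minimal {x : V} (p : G.Walk x x) (hodd : Odd p.length)
    (hmin : ∀ (y : V) (q : G.Walk y y), Odd q.length → p.length ≤ q.length) : p.IsCycle := by
  have hinj : ∀ i j, i < j → j ≤ p.length → ¬ (i = 0 ∧ j = p.length) →
      p.getVert i ≠ p.getVert j := by
    intro i j hij hj hne he
    have h1 := hmin _ (((p.drop i).take (j - i)).copy rfl
      (by rw [drop_getVert, Nat.add_sub_cancel' hij.le, ← he]))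
    have h2 := hmin _ (((p.take i).copy rfl he).append (p.drop j))
    simp only [length_copy, length_append, take_length, drop_length] at h1 h2
    rw [Nat.odd_iff] at h1 h2 hodd
    grind
  refine Walk.isCycle_iff_isPath_tail_and_le_length.2 ⟨?_, ?_⟩
  · have htail : p.tail.length + 1 = p.length :=
      length_tail_add_one (not_nil_iff_lt_length.2 hodd.pos)
    rw [← IsPath.getVert_injOn_iff]
    intro i hi j hj hij
    simp only [Set.mem_ofPred_eq] at hi hj
    rw [getVert_tail, getVert_tail] at hij
    by_contra hne
    rcases lt_or_gt_of_ne hne with hlt | hlt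
    · exact hinj (i + 1) (j + 1) (by lia) (by lia) (by lia) hij
    · exact hinj (j + 1) (i + 1) (by lia) (by lia) (by lia) hij.symm
  · have hne : p.length ≠ 1 := fun h1 ↦ G.irrefl (adj_of_length_eq_one h1)
    grind

/-- Consecutive values of a sequence of pairwise adjacent vertices are joined by walks. -/
lemma exists_walk_of_adj_succ {f : ℕ → V} (hf : ∀ i, G.Adj (f i) (f (i + 1))) (i t : ℕ) :
    ∃ q : G.Walk (f i) (f (i + t)), q.length = t := by
  induction t with
  | zero => exact ⟨.nil, rfl⟩
  | succ t ih =>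
    obtain ⟨q, hq⟩ := ih
    exact ⟨q.concat (hf (i + t)), by simp [hq]⟩

/-- A periodic parametrization of a shortest odd cycle of a non-bipartite graph. -/
lemma exists_shortest_odd_cycle (hG : ¬ G.Colorable 2) {L : ℕ}
    (hfree : ∀ (x : V) (c : G.Walk x x), c.IsCycle → Odd c.length → L < c.length) :
    ∃ (N : ℕ) (f : ℕ → V), Odd N ∧ L < N ∧ (∀ i, f (i + N) = f i) ∧
      (∀ i, G.Adj (f i) (f (i + 1))) ∧
      ∀ (x : V) (q : G.Walk x x), Odd q.length → N ≤ q.length := by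
  classical
  have hex : ∃ N, ∃ (x : V) (p : G.Walk x x), Odd p.length ∧ p.length = N := by
    rw [two_colorable_iff_forall_loop_even] at hG
    push Not at hG
    obtain ⟨x, p, hp⟩ := hG
    exact ⟨_, x, p, Nat.not_even_iff_odd.1 hp, rfl⟩
  obtain ⟨x, p, hodd, hlen⟩ := Nat.find_spec hex
  have hmin : ∀ (y : V) (q : G.Walk y y), Odd q.length → p.length ≤ q.length :=
    fun y q hq ↦ hlen ▸ Nat.find_min' hex ⟨y, q, hq, rfl⟩
  refine ⟨p.length, fun i ↦ p.getVert (i % p.length), hodd,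
    hfree x p (p.isCycle_of_odd_minimal hodd hmin) hodd, by simp, fun i ↦ ?_, hmin⟩
  have hlt : i % p.length < p.length := Nat.mod_lt _ hodd.pos
  have hadj := p.adj_getVert_succ hlt
  rcases Nat.lt_or_ge (i % p.length + 1) p.length with h | h
  · have : (i + 1) % p.length = i % p.length + 1 := by
      rw [← Nat.mod_add_mod, Nat.mod_eq_of_lt h]
    simpa only [this] using hadj
  · have h1 : i % p.length + 1 = p.length := by lia
    have : (i + 1) % p.length = 0 := by
      rw [← Nat.mod_add_mod, h1, Nat.mod_self]
    simp only [this, Walk.getVert_zero]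
    simpa only [h1, Walk.getVert_length] using hadj

/-- Walks of even length between vertices of a shortest odd cycle are at least as long as the
even arc of the cycle. -/
lemma even_arc_le_length {N : ℕ} {f : ℕ → V} (hN : Odd N) (hper : ∀ i, f (i + N) = f i)
    (hadj : ∀ i, G.Adj (f i) (f (i + 1)))
    (hmin : ∀ (x : V) (q : G.Walk x x), Odd q.length → N ≤ q.length)
    {s t : ℕ} (ht : t ≤ N) (q : G.Walk (f (2 * s)) (f (2 * (s + t)))) (hq : Even q.length) :
    2 * t ≤ q.length ∨ 2 * (N - t) ≤ q.length := by
  rcases Nat.lt_or_ge (2 * t) N with h | h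
  · obtain ⟨r, hr⟩ := exists_walk_of_adj_succ hadj (2 * (s + t)) (N - 2 * t)
    have he : f (2 * (s + t) + (N - 2 * t)) = f (2 * s) := by
      rw [← hper (2 * s)]; congr 1; lia
    have := hmin _ (q.append (r.copy rfl he))
    simp only [Walk.length_append, Walk.length_copy, hr] at this
    grind
  · obtain ⟨r, hr⟩ := exists_walk_of_adj_succ hadj (2 * s + N) (2 * t - N)
    have he : f (2 * s + N + (2 * t - N)) = f (2 * (s + t)) := by congr 1; lia
    have := hmin _ (q.append (r.copy (hper _) he).reverse)
    simp only [Walk.length_append, Walk.length_copy, Walk.length_reverse, hr] at this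
    grind

/-- A set of residues modulo `N ≥ 7` of pairwise cyclic distance at most `2` lies in
an interval of three consecutive residues. -/
lemma exists_shift_of_pairwise_close {N : ℕ} (hN : 7 ≤ N) {P : ℕ → Prop}
    (hper : ∀ i, P (i + N) ↔ P i)
    (hclose : ∀ i t, t ≤ N → P i → P (i + t) → t ≤ 2 ∨ N ≤ t + 2) :
    ∃ s, ∀ j < N, P (s + j) → j ≤ 2 := by
  by_cases h2 : ∃ i, P i ∧ P (i + 2)
  · obtain ⟨i, hi, hi2⟩ := h2
    refine ⟨i, fun j hj hP ↦ ?_⟩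
    by_contra hlt
    have h := hclose i j hj.le hi hP
    have h' := hclose (i + 2) (j - 2) (by lia) hi2 (by rwa [show i + 2 + (j - 2) = i + j by lia])
    lia
  by_cases h1 : ∃ i, P i ∧ P (i + 1)
  · obtain ⟨i, hi, hi1⟩ := h1
    refine ⟨i, fun j hj hP ↦ ?_⟩
    by_contra hlt
    have h' := hclose (i + 1) (j - 1) (by lia) hi1 (by rwa [show i + 1 + (j - 1) = i + j by lia])
    refine h2 ⟨i + j, hP, ?_⟩
    rw [show i + j + 2 = i + 1 + N by grind]
    exact (hper _).2 hi1
  by_cases h0 : ∃ i, P i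
  · obtain ⟨i, hi⟩ := h0
    refine ⟨i, fun j hj hP ↦ ?_⟩
    by_contra hlt
    have h := hclose i j hj.le hi hP
    rcases (by lia : j + 2 = N ∨ j + 1 = N) with h | h
    · exact h2 ⟨i + j, hP, by rw [add_assoc, h]; exact (hper _).2 hi⟩
    · exact h1 ⟨i + j, hP, by rw [add_assoc, h]; exact (hper _).2 hi⟩
  · exact ⟨0, fun j _ hP ↦ (h0 ⟨_, hP⟩).elim⟩

/-- The vertices of a shortest odd cycle, listed in steps of two from a starting point chosen
such that only the first three of them can have a common neighbor with `v`. -/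
lemma exists_odd_cycle_listing (hG : ¬ G.Colorable 2) {k : ℕ} (hk : 2 ≤ k)
    (hfree : ∀ (x : V) (c : G.Walk x x), c.IsCycle → Odd c.length → 2 * k + 1 < c.length) (v : V) :
    ∃ (N : ℕ) (d : ℕ → V), 2 * k + 3 ≤ N ∧
      (∀ w i j, i ≤ j → j < N → G.Adj w (d i) → G.Adj w (d j) → j ≤ i + 1 ∨ N ≤ j + 1 - i) ∧
      (∀ w j, j < N → G.Adj v w → G.Adj w (d j) → j ≤ 2) ∧
      ∃ u, G.Adj u (d 0) ∧ G.Adj u (d (N - 1)) := by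
  obtain ⟨N, f, hN, hL, hper, hadj, hmin⟩ := exists_shortest_odd_cycle hG hfree
  have hkN : 2 * k + 3 ≤ N := by grind
  obtain ⟨s, hs⟩ := exists_shift_of_pairwise_close (N := N)
    (P := fun i ↦ ∃ w, G.Adj v w ∧ G.Adj w (f (2 * i))) (by lia)
    (fun i ↦ by rw [show 2 * (i + N) = 2 * i + N + N by lia, hper, hper])
    (by
      rintro i t ht ⟨w, hvw, hw⟩ ⟨w', hvw', hw'⟩
      have := even_arc_le_length hN hper hadj hmin ht
        (.cons hw.symm <| .cons hvw.symm <| .cons hvw' <| .cons hw' .nil) (by simp; decide)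
      simp only [Walk.length_cons, Walk.length_nil] at this
      lia)
  refine ⟨N, fun j ↦ f (2 * (s + j)), hkN, fun w i j hij hj hi hj' ↦ ?_,
    fun w j hj hvw hw ↦ hs j hj ⟨w, hvw, hw⟩, f (2 * s + (N - 1)), ?_, ?_⟩
  · obtain ⟨t, rfl⟩ := Nat.exists_eq_add_of_le hij
    simp only [← add_assoc s i t] at hj'
    have := even_arc_le_length hN hper hadj hmin (by lia) (.cons hi.symm <| .cons hj' .nil)
      (by simp)
    simp only [Walk.length_cons, Walk.length_nil] at this
    lia
  · have := hadj (2 * s + (N - 1))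
    rwa [show 2 * s + (N - 1) + 1 = 2 * s + N by lia, hper] at this
  · have := (hadj (2 * s + (N - 2))).symm
    rwa [← hper (2 * s + (N - 2)), show 2 * s + (N - 2) + N = 2 * (s + (N - 1)) by lia,
      show 2 * s + (N - 2) + 1 = 2 * s + (N - 1) by lia] at this

open Finset in
/-- Double counting the edges between all vertices and a family of vertices containing `v`. -/
lemma degree_add_card_mul_minDegree_le [Fintype V] [DecidableRel G.Adj] (v : V) (d : ℕ → V)
    (J : Finset ℕ) (c : V → ℕ)
    (hc : ∀ w, (if G.Adj v w then 1 else 0) + #{j ∈ J | G.Adj w (d j)} ≤ c w) :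
    G.degree v + #J * G.minDegree ≤ ∑ w, c w := by
  calc G.degree v + #J * G.minDegree
      ≤ G.degree v + ∑ j ∈ J, G.degree (d j) := by
        gcongr
        simpa using J.card_nsmul_le_sum (fun j ↦ G.degree (d j)) _
          fun j _ ↦ G.minDegree_le_degree (d j)
    _ = ∑ w, ((if G.Adj v w then 1 else 0) + #{j ∈ J | G.Adj w (d j)}) := by
        rw [sum_add_distrib]
        congr 1
        · rw [sum_boole, ← card_neighborFinset_eq_degree, neighborFinset_eq_filter, Nat.cast_id]
        · simp_rw [card_filter]
          rw [sum_comm]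
          refine sum_congr rfl fun j _ ↦ ?_
          rw [sum_boole, ← card_neighborFinset_eq_degree, neighborFinset_eq_filter, Nat.cast_id]
          simp_rw [G.adj_comm]
    _ ≤ ∑ w, c w := sum_le_sum fun w _ ↦ hc w

open Finset in
/-- The degree bounds satisfied by non-bipartite graphs without short odd cycles. -/
lemma degree_bounds_of_not_colorable_two [Fintype V] [DecidableRel G.Adj] (hG : ¬ G.Colorable 2)
    {k : ℕ} (hk : 2 ≤ k)
    (hfree : ∀ (x : V) (c : G.Walk x x), c.IsCycle → Odd c.length → 2 * k + 1 < c.length) (v : V) :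
    G.degree v + (2 * k + 2) * G.minDegree ≤ 2 * Fintype.card V ∧
      G.degree v + k * G.minDegree + 1 ≤ Fintype.card V := by
  classical
  obtain ⟨N, d, hN, hclose, hv, u, hu0, huN⟩ := exists_odd_cycle_listing hG hk hfree v
  constructor
  · have h := degree_add_card_mul_minDegree_le (G := G) v d ((range N).erase 1) (fun _ ↦ 2) ?_
    · rw [card_erase_of_mem (by simp; lia), card_range] at h
      simp only [sum_const, card_univ, smul_eq_mul] at h
      have : (2 * k + 2) * G.minDegree ≤ (N - 1) * G.minDegree :=
        Nat.mul_le_mul_right _ (by lia)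
      lia
    · intro w
      split_ifs with hvw
      · suffices #{j ∈ (range N).erase 1 | G.Adj w (d j)} ≤ 1 by lia
        rw [card_le_one]
        simp only [mem_filter, mem_erase, mem_range]
        rintro i ⟨⟨hi1, hiN⟩, hi⟩ j ⟨⟨hj1, hjN⟩, hj⟩
        have := hv w i hiN hvw hi
        have := hv w j hjN hvw hj
        rcases le_total i j with hij | hij
        · have := hclose w i j hij hjN hi hj
          lia
        · have := hclose w j i hij hiN hj hi
          lia
      · rw [zero_add]
        by_contra! hlt
        obtain ⟨a, b, c, ha, hb, hc, hab, hac, hbc⟩ := two_lt_card_iff.1 hlt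
        simp only [mem_filter, mem_erase, mem_range] at ha hb hc
        have := hclose w a b
        have := hclose w b a
        have := hclose w a c
        have := hclose w c a
        have := hclose w b c
        have := hclose w c b
        grind
  · have hu : ∀ i < k, ¬ G.Adj u (d (2 * i + 3)) := fun i hi hadj ↦ by
      have := hclose u 0 (2 * i + 3) (by lia) (by lia) hu0 hadj
      lia
    have h := degree_add_card_mul_minDegree_le (G := G) v (fun i ↦ d (2 * i + 3)) (range k)
      (fun w ↦ if w ≠ u then 1 else 0) ?_
    · rw [card_range, sum_boole, filter_ne', card_erase_of_mem (mem_univ _), card_univ,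
        Nat.cast_id] at h
      have := Fintype.card_pos_iff.2 ⟨v⟩
      lia
    · intro w
      by_cases hwu : w = u
      · subst hwu
        have hvw : ¬ G.Adj v w := fun hvw ↦ by
          have := hv w (N - 1) (by lia) hvw huN
          lia
        simpa [hvw, filter_eq_empty_iff] using hu
      · rw [if_pos hwu]
        split_ifs with hvw
        · rw [filter_eq_empty_iff.2, card_empty]
          intro i hi hadj
          rw [mem_range] at hi
          have := hv w (2 * i + 3) (by lia) hvw hadj
          lia
        · rw [zero_add, card_le_one]
          simp only [mem_filter, mem_range]
          rintro i ⟨hik, hi⟩ j ⟨hjk, hj⟩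
          rcases le_total i j with hij | hij
          · have := hclose w (2 * i + 3) (2 * j + 3) (by lia) (by lia) hi hj
            lia
          · have := hclose w (2 * j + 3) (2 * i + 3) (by lia) (by lia) hj hi
            lia

end SimpleGraph

/-- Let `k ≥ 2`. If `G` is an `n`-vertex simple graph containing no odd cycle of length
at most `2k+1`, with `δ(G) > min{ n/(k+1) − Δ(G)/(2k+2), (n − 1 − Δ(G))/k }`, then `G`
is bipartite. -/
theorem stmt_5 {V : Type*} [Fintype V] (k : ℕ) (hk : 2 ≤ k)
    (G : SimpleGraph V) [DecidableRel G.Adj]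
    (hfree : ∀ (x : V) (c : G.Walk x x), c.IsCycle → Odd c.length → 2 * k + 1 < c.length)
    (hdeg : (G.minDegree : ℝ) >
      min ((Fintype.card V : ℝ) / ((k : ℝ) + 1) - (G.maxDegree : ℝ) / (2 * (k : ℝ) + 2))
          (((Fintype.card V : ℝ) - 1 - (G.maxDegree : ℝ)) / (k : ℝ))) :
    G.Colorable 2 := by
  by_contra hG
  have hne : Nonempty V := by
    by_contra hV
    rw [not_nonempty_iff] at hV
    exact hG (.of_isEmpty 2)
  obtain ⟨v, hv⟩ := G.exists_maximal_degree_vertex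
  obtain ⟨h₁, h₂⟩ := SimpleGraph.degree_bounds_of_not_colorable_two hG hk hfree v
  rw [← hv] at h₁ h₂
  have hk0 : (0 : ℝ) < k := by positivity
  rify at h₁ h₂
  rcases min_lt_iff.1 hdeg with h | h
  · have hsub : (Fintype.card V : ℝ) / (k + 1) - G.maxDegree / (2 * k + 2) =
        (2 * Fintype.card V - G.maxDegree) / (2 * k + 2) := by
      field_simp
    rw [hsub, div_lt_iff₀ (by positivity)] at h
    linarith
  · rw [div_lt_iff₀ hk0] at h
    linarith
end

section
/- Let k ≥ 2 be an integer. Suppose G is an n-vertex C_{≤2k+1}-free simple graph satisfying (2k+2)·δ(G) + Δ(G) > 2n (equivalently, δ(G) > n/(k+1) − Δ(G)/(2k+2)). Then G is bipartite. -/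
namespace SimpleGraph

variable {V : Type*} {G : SimpleGraph V}

lemma Walk.exists_between {u v : V} (p : G.Walk u v) {i j : ℕ} (hij : i ≤ j) (hj : j ≤ p.length) :
    ∃ q : G.Walk (p.getVert i) (p.getVert j), q.length = j - i := by
  have h : (p.drop i).getVert (j - i) = p.getVert j := by
    rw [Walk.drop_getVert]; congr 1; lia
  refine ⟨((p.drop i).take (j - i)).copy rfl h, ?_⟩
  rw [Walk.length_copy, Walk.take_length, Walk.drop_length]
  lia

/-- A closed walk of minimum length among the closed walks of odd length is a cycle. -/
lemma Walk.isCycle_of_odd_of_minimal {u : V} (p : G.Walk u u) (hodd : Odd p.length)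
    (hmin : ∀ (x : V) (c : G.Walk x x), Odd c.length → p.length ≤ c.length) : p.IsCycle := by
  have h1 : p.length ≠ 1 := fun h ↦ (Walk.adj_of_length_eq_one h).ne rfl
  have h3 : 3 ≤ p.length := by
    obtain ⟨m, hm⟩ := hodd
    lia
  have hnil : ¬ p.Nil := by
    rw [← Walk.length_eq_zero_iff]
    lia
  have key : ∀ i j, 1 ≤ i → i < j → j ≤ p.length → p.getVert i ≠ p.getVert j := by
    intro i j hi hij hj heq
    obtain ⟨q, hq⟩ := p.exists_between hij.le hj
    obtain ⟨a, ha⟩ := p.exists_between (Nat.zero_le i) (hij.le.trans hj)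
    obtain ⟨b, hb⟩ := p.exists_between hj le_rfl
    have h₁ := hmin _ (q.copy rfl heq.symm)
    have h₂ := hmin _ ((a.copy p.getVert_zero heq).append (b.copy rfl p.getVert_length))
    simp only [Walk.length_copy, Walk.length_append, Nat.odd_iff] at h₁ h₂ hodd
    lia
  refine Walk.isCycle_iff_isPath_tail_and_le_length.mpr
    ⟨(Walk.IsPath.getVert_injOn_iff _).mp fun i hi j hj hij ↦ ?_, h3⟩
  have hl := Walk.length_tail_add_one hnil
  simp only [Set.mem_ofPred_eq] at hi hj
  rw [Walk.getVert_tail, Walk.getVert_tail] at hij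
  rcases lt_trichotomy i j with h | h | h
  · exact absurd hij (key _ _ (by lia) (by lia) (by lia))
  · exact h
  · exact absurd hij.symm (key _ _ (by lia) (by lia) (by lia))

/-- If `w` is adjacent to the `i`-th and `j`-th vertices of a closed walk, then `w` lies on closed
walks that traverse either of the two arcs between these vertices. -/
lemma Walk.exists_closed_of_adj {u : V} (p : G.Walk u u) {w : V} {i j : ℕ} (hij : i < j)
    (hj : j ≤ p.length) (hi' : G.Adj w (p.getVert i)) (hj' : G.Adj w (p.getVert j)) :
    (∃ c : G.Walk w w, c.length = j - i + 2) ∧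
      ∃ c : G.Walk w w, c.length = p.length - (j - i) + 2 := by
  obtain ⟨q, hq⟩ := p.exists_between hij.le hj
  obtain ⟨a, ha⟩ := p.exists_between (Nat.zero_le i) (hij.le.trans hj)
  obtain ⟨b, hb⟩ := p.exists_between hj le_rfl
  refine ⟨⟨Walk.cons hi' (q.concat hj'.symm), by simp [hq]⟩,
    ⟨Walk.cons hj' (((b.copy rfl p.getVert_length).append
      (a.copy p.getVert_zero rfl)).concat hi'.symm), ?_⟩⟩
  simp only [Walk.length_cons, Walk.length_concat, Walk.length_append, Walk.length_copy]
  lia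

/-- If `v` is adjacent to the base of a closed walk and to a neighbour `w` of its `i`-th vertex,
then `v` lies on closed walks that traverse either of the two arcs from the base to that vertex. -/
lemma Walk.exists_closed_of_adj_adj {u : V} (p : G.Walk u u) {v w : V} {i : ℕ} (hi : i ≤ p.length)
    (hvu : G.Adj v u) (hvw : G.Adj v w) (hw : G.Adj w (p.getVert i)) :
    (∃ c : G.Walk v v, c.length = i + 3) ∧ ∃ c : G.Walk v v, c.length = p.length - i + 3 := by
  obtain ⟨a, ha⟩ := p.exists_between (Nat.zero_le i) hi
  obtain ⟨b, hb⟩ := p.exists_between hi le_rfl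
  refine ⟨⟨Walk.cons hvu (((a.copy p.getVert_zero rfl).concat hw.symm).concat hvw.symm), ?_⟩,
    ⟨Walk.cons hvw (Walk.cons hw ((b.copy rfl p.getVert_length).concat hvu.symm)), ?_⟩⟩ <;>
  · simp only [Walk.length_cons, Walk.length_concat, Walk.length_copy]
    lia

/-- Two neighbours of a vertex on a shortest odd closed walk are at distance two along it. -/
lemma Walk.eq_of_adj_of_minimal {u : V} (p : G.Walk u u) (hodd : Odd p.length)
    (hmin : ∀ (x : V) (c : G.Walk x x), Odd c.length → p.length ≤ c.length) {w : V} {i j : ℕ}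
    (hij : i < j) (hj : j < p.length) (hi' : G.Adj w (p.getVert i))
    (hj' : G.Adj w (p.getVert j)) : j = i + 2 ∨ j + 2 = i + p.length := by
  obtain ⟨⟨c, hc⟩, d, hd⟩ := p.exists_closed_of_adj hij hj.le hi' hj'
  have h₁ := hmin _ c
  have h₂ := hmin _ d
  simp only [Nat.odd_iff] at h₁ h₂ hodd
  lia

section Count

variable [Fintype V] [DecidableRel G.Adj]

lemma card_mul_minDegree_add_degree_le (f : ℕ → V) (S : Finset ℕ) (v : V)
    (htwo : ∀ w, (S.filter fun i ↦ G.Adj w (f i)).card ≤ 2)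
    (hone : ∀ w, G.Adj v w → (S.filter fun i ↦ G.Adj w (f i)).card ≤ 1) :
    S.card * G.minDegree + G.degree v ≤ 2 * Fintype.card V := by
  have h₁ : S.card * G.minDegree ≤ ∑ w, (S.filter fun i ↦ G.Adj w (f i)).card :=
    calc S.card * G.minDegree ≤ ∑ i ∈ S, G.degree (f i) := by
          simpa using S.card_nsmul_le_sum (fun i ↦ G.degree (f i)) G.minDegree
            fun i _ ↦ G.minDegree_le_degree _
      _ = ∑ i ∈ S, (Finset.univ.bipartiteAbove (fun i w ↦ G.Adj w (f i)) i).card := by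
          refine Finset.sum_congr rfl fun i _ ↦ ?_
          rw [← card_neighborFinset_eq_degree]
          congr 1
          ext w
          simp [adj_comm]
      _ = _ := Finset.sum_card_bipartiteAbove_eq_sum_card_bipartiteBelow _
  have h₂ : G.degree v = ∑ w, if G.Adj v w then 1 else 0 := by
    rw [← card_neighborFinset_eq_degree, neighborFinset_eq_filter, Finset.card_filter]
  calc S.card * G.minDegree + G.degree v
      ≤ ∑ w, ((S.filter fun i ↦ G.Adj w (f i)).card + if G.Adj v w then 1 else 0) := by
        rw [Finset.sum_add_distrib, ← h₂]
        lia
    _ ≤ ∑ _w : V, 2 := by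
        refine Finset.sum_le_sum fun w _ ↦ ?_
        have := htwo w
        have := hone w
        split_ifs <;> grind
    _ = 2 * Fintype.card V := by simp [mul_comm]

/-- A shortest odd closed walk in which each neighbour of `v` sees at most one of the chosen
positions yields the degree bound. -/
lemma Walk.card_mul_minDegree_add_degree_le {u : V} (p : G.Walk u u) (hodd : Odd p.length)
    (hlen : 7 ≤ p.length)
    (hmin : ∀ (x : V) (c : G.Walk x x), Odd c.length → p.length ≤ c.length)
    {S : Finset ℕ} (hS : ∀ i ∈ S, i < p.length) (v : V)
    (hone : ∀ w i j, G.Adj v w → i ∈ S → j ∈ S → i < j → G.Adj w (p.getVert i) →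
      ¬ G.Adj w (p.getVert j)) :
    S.card * G.minDegree + G.degree v ≤ 2 * Fintype.card V := by
  refine SimpleGraph.card_mul_minDegree_add_degree_le p.getVert S v (fun w ↦ ?_)
    fun w hw ↦ ?_
  · by_contra! h
    obtain ⟨a, b, c, ha, hb, hc, hab, hac, hbc⟩ := Finset.two_lt_card_iff.mp h
    rw [Finset.mem_filter] at ha hb hc
    have key : ∀ i j, (i ∈ S ∧ G.Adj w (p.getVert i)) → (j ∈ S ∧ G.Adj w (p.getVert j)) →
        i < j → j = i + 2 ∨ j + 2 = i + p.length := fun i j hi hj hij ↦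
      p.eq_of_adj_of_minimal hodd hmin hij (hS j hj.1) hi.2 hj.2
    have := key a b ha hb
    have := key b a hb ha
    have := key a c ha hc
    have := key c a hc ha
    have := key b c hb hc
    have := key c b hc hb
    have := hS a ha.1
    have := hS b hb.1
    have := hS c hc.1
    obtain ⟨m, hm⟩ := hodd
    lia
  · refine Finset.card_le_one.mpr fun a ha b hb ↦ ?_
    rw [Finset.mem_filter] at ha hb
    rcases lt_trichotomy a b with h | h | h
    · exact absurd hb.2 (hone w a b hw ha.1 hb.1 h ha.2)
    · exact h
    · exact absurd ha.2 (hone w b a hw hb.1 ha.1 h hb.2)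

/-- If the shortest odd closed walk has length `g ≥ 7`, then `(g - 1) δ(G) + d(v) ≤ 2 |V|` for
every vertex `v`. -/
lemma Walk.pred_length_mul_minDegree_add_degree_le {u : V} (p : G.Walk u u) (hodd : Odd p.length)
    (hlen : 7 ≤ p.length)
    (hmin : ∀ (x : V) (c : G.Walk x x), Odd c.length → p.length ≤ c.length) (v : V) :
    (p.length - 1) * G.minDegree + G.degree v ≤ 2 * Fintype.card V := by
  have hodd' := Nat.odd_iff.mp hodd
  by_cases hv : ∃ c : G.Walk v v, c.length = p.length
  · obtain ⟨c, hc⟩ := hv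
    rw [← hc] at hodd hlen hmin ⊢
    have := c.card_mul_minDegree_add_degree_le hodd hlen hmin (S := Finset.Ico 1 c.length)
      (fun i hi ↦ (Finset.mem_Ico.mp hi).2) v ?_
    · simpa using this
    · intro w i j hw hi hj hij hwi hwj
      rw [Finset.mem_Ico] at hi hj
      have h0 : G.Adj w (c.getVert 0) := by simpa using hw.symm
      have h₁ := c.eq_of_adj_of_minimal hodd hmin (by lia) hi.2 h0 hwi
      have h₂ := c.eq_of_adj_of_minimal hodd hmin (by lia) hj.2 h0 hwj
      have h₃ := c.eq_of_adj_of_minimal hodd hmin hij hj.2 hwi hwj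
      lia
  by_cases hN : ∃ x, G.Adj v x ∧ ∃ c : G.Walk x x, c.length = p.length
  · obtain ⟨x, hvx, c, hc⟩ := hN
    rw [← hc] at hodd hodd' hlen hmin hv ⊢
    have hmin' (d : G.Walk v v) (hd : Odd d.length) : c.length < d.length :=
      (hmin v d hd).lt_of_ne fun h ↦ hv ⟨d, h.symm⟩
    have := c.card_mul_minDegree_add_degree_le hodd hlen hmin
      (S := (Finset.range c.length).erase 1)
      (fun i hi ↦ Finset.mem_range.mp (Finset.mem_of_mem_erase hi)) v ?_
    · rwa [Finset.card_erase_of_mem (by simp; lia), Finset.card_range] at this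
    · intro w i j hw hi hj hij hwi hwj
      rw [Finset.mem_erase, Finset.mem_range] at hi hj
      have h := c.eq_of_adj_of_minimal hodd hmin hij hj.2 hwi hwj
      obtain ⟨⟨a, ha⟩, b, hb⟩ := c.exists_closed_of_adj_adj hi.2.le hvx hw hwi
      have h₁ := hmin' a
      have h₂ := hmin' b
      simp only [Nat.odd_iff] at h₁ h₂
      lia
  · have := p.card_mul_minDegree_add_degree_le hodd hlen hmin (S := Finset.range p.length)
      (fun i hi ↦ Finset.mem_range.mp hi) v ?_
    · rw [Finset.card_range] at this
      exact (Nat.add_le_add_right (Nat.mul_le_mul_right _ (Nat.sub_le _ _)) _).trans this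
    · intro w i j hw hi hj hij hwi hwj
      rw [Finset.mem_range] at hi hj
      have h := p.eq_of_adj_of_minimal hodd hmin hij hj hwi hwj
      obtain ⟨⟨a, ha⟩, b, hb⟩ := p.exists_closed_of_adj hij hj.le hwi hwj
      rcases h with h | h
      · exact hN ⟨w, hw, b, by lia⟩
      · exact hN ⟨w, hw, a, by lia⟩

end Count

end SimpleGraph

/-- Let `k ≥ 2`. If `G` is an `n`-vertex simple graph containing no odd cycle of length
at most `2k+1`, with `(2k+2)·δ(G) + Δ(G) > 2n`, then `G` is bipartite. -/
theorem stmt_6 {V : Type*} [Fintype V] (k : ℕ) (hk : 2 ≤ k)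
    (G : SimpleGraph V) [DecidableRel G.Adj]
    (hfree : ∀ (x : V) (c : G.Walk x x), c.IsCycle → Odd c.length → 2 * k + 1 < c.length)
    (hdeg : 2 * Fintype.card V < (2 * k + 2) * G.minDegree + G.maxDegree) :
    G.Colorable 2 := by
  classical
  rw [SimpleGraph.two_colorable_iff_forall_loop_even]
  by_contra! h
  obtain ⟨x, c, hc⟩ := h
  have hex : ∃ n, Odd n ∧ ∃ (u : V) (p : G.Walk u u), p.length = n :=
    ⟨c.length, Nat.not_even_iff_odd.mp hc, x, c, rfl⟩
  obtain ⟨hodd, u, p, hp⟩ := Nat.find_spec hex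
  have hmin : ∀ (y : V) (d : G.Walk y y), Odd d.length → p.length ≤ d.length :=
    fun y d hd ↦ hp ▸ Nat.find_min' hex ⟨hd, y, d, rfl⟩
  rw [← hp] at hodd
  have hlen := hfree u p (p.isCycle_of_odd_of_minimal hodd hmin) hodd
  have hlen' : 2 * k + 2 ≤ p.length - 1 := by
    obtain ⟨m, hm⟩ := hodd
    lia
  have : Nonempty V := ⟨x⟩
  obtain ⟨v, hv⟩ := G.exists_maximal_degree_vertex
  have hle := p.pred_length_mul_minDegree_add_degree_le hodd (by lia) hmin v
  rw [← hv] at hle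
  have := Nat.mul_le_mul_right G.minDegree hlen'
  lia
end

section
/- Let k ≥ 2 be an integer. Suppose G is an n-vertex C_{≤2k+1}-free simple graph satisfying k·δ(G) + Δ(G) > n − 1 (equivalently, δ(G) > (n − 1 − Δ(G))/k). Then G is bipartite. -/
namespace SimpleGraph

variable {V : Type*} {G : SimpleGraph V}

/-- A sequence of successively adjacent vertices contains walks between any two of its terms. -/
lemma exists_walk_length_eq_of_forall_adj {c : ℕ → V} (hadj : ∀ n, G.Adj (c n) (c (n + 1)))
    (i d : ℕ) : ∃ w : G.Walk (c i) (c (i + d)), w.length = d := by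
  induction d with
  | zero => exact ⟨.nil, rfl⟩
  | succ d ih =>
    obtain ⟨w, hw⟩ := ih
    exact ⟨w.concat (hadj (i + d)), by simp [hw]⟩

/-- An `L`-periodic sequence of successively adjacent vertices, where `L` is odd and is the least
length of an odd closed walk: a shortest odd cycle, traversed indefinitely. -/
structure IsShortestOddTour (G : SimpleGraph V) (L : ℕ) (c : ℕ → V) : Prop where
  odd : Odd L
  adj : ∀ n, G.Adj (c n) (c (n + 1))
  periodic : ∀ n, c (n + L) = c n
  le_length : ∀ (x : V) (w : G.Walk x x), Odd w.length → L ≤ w.length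

lemma exists_isShortestOddTour {x : V} {w : G.Walk x x} (hw : Odd w.length)
    (hmin : ∀ (y : V) (w' : G.Walk y y), Odd w'.length → w.length ≤ w'.length) :
    G.IsShortestOddTour w.length (fun n ↦ w.getVert (n % w.length)) where
  odd := hw
  adj n := by
    have hlt : n % w.length < w.length := Nat.mod_lt _ hw.pos
    have h := w.adj_getVert_succ hlt
    have hnext : w.getVert ((n + 1) % w.length) = w.getVert (n % w.length + 1) := by
      rcases Nat.lt_or_ge (n % w.length + 1) w.length with h1 | h1
      · rw [Nat.add_mod_eq_ite]
        have h2 : 1 % w.length = 1 := Nat.mod_eq_of_lt (by omega)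
        rw [h2, if_neg (by omega)]
      · have h2 : n % w.length + 1 = w.length := by omega
        have h3 : (n + 1) % w.length = 0 := by
          rw [← Nat.mod_add_mod, h2, Nat.mod_self]
        rw [h3, h2, w.getVert_zero, w.getVert_length]
    simpa only [hnext] using h
  periodic n := by simp
  le_length := hmin

namespace IsShortestOddTour

variable {L : ℕ} {c : ℕ → V}

lemma le_add_length (hc : G.IsShortestOddTour L c) {i d : ℕ} (w : G.Walk (c i) (c (i + d)))
    (hodd : Odd (d + w.length)) : L ≤ d + w.length := by
  obtain ⟨q, hq⟩ := exists_walk_length_eq_of_forall_adj hc.adj i d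
  have h := hc.le_length _ (q.append w.reverse) (by simpa [hq] using hodd)
  simpa [hq] using h

/-- The other arc of the tour gives the bound for a walk of the same parity as the first arc. -/
lemma le_length_or_two_mul_le (hc : G.IsShortestOddTour L c) {i d : ℕ}
    (w : G.Walk (c i) (c (i + d))) (heven : Even (d + w.length)) :
    d ≤ w.length ∨ 2 * L ≤ d + w.length := by
  have hL := hc.odd
  rcases Nat.le_total d L with hd | hd
  · left
    have hi : c (i + d + (L - d)) = c i := by
      rw [show i + d + (L - d) = i + L by omega, hc.periodic]
    have h := hc.le_add_length (w.reverse.copy rfl hi.symm) (by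
      simp only [Walk.length_copy, Walk.length_reverse]
      grind)
    simp only [Walk.length_copy, Walk.length_reverse] at h
    omega
  · right
    have hi : c (i + d) = c (i + (d - L)) := by
      rw [show i + d = i + (d - L) + L by omega, hc.periodic]
    have h := hc.le_add_length (w.copy rfl hi) (by
      simp only [Walk.length_copy]
      grind)
    simp only [Walk.length_copy] at h
    omega

lemma eq_of_apply_eq (hc : G.IsShortestOddTour L c) {i j : ℕ} (hij : i ≤ j) (hj : j < i + L)
    (h : c i = c j) : i = j := by
  obtain ⟨d, rfl⟩ := Nat.exists_eq_add_of_le hij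
  rcases Nat.even_or_odd d with hd | hd
  · have := hc.le_length_or_two_mul_le (Walk.nil.copy rfl h) (by simpa using hd)
    simp only [Walk.length_copy, Walk.length_nil] at this
    omega
  · have := hc.le_add_length (Walk.nil.copy rfl h) (by simpa using hd)
    simp only [Walk.length_copy, Walk.length_nil] at this
    omega

lemma common_neighbor (hc : G.IsShortestOddTour L c) {i d : ℕ} {u : V}
    (hi : G.Adj u (c i)) (hd : G.Adj u (c (i + d))) :
    (Even d ∧ (d ≤ 2 ∨ 2 * L ≤ d + 2)) ∨ (Odd d ∧ L ≤ d + 2) := by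
  let w : G.Walk (c i) (c (i + d)) := .cons hi.symm (.cons hd .nil)
  have hw : w.length = 2 := rfl
  rcases Nat.even_or_odd d with h | h
  · have := hc.le_length_or_two_mul_le w (by rw [hw]; grind)
    rw [hw] at this
    exact .inl ⟨h, this⟩
  · have := hc.le_add_length w (by rw [hw]; grind)
    rw [hw] at this
    exact .inr ⟨h, this⟩

lemma card_filter_adj_le_two [DecidableRel G.Adj] (hc : G.IsShortestOddTour L c) (hL : 7 ≤ L)
    (u : V) : ((Finset.range L).filter fun i ↦ G.Adj u (c i)).card ≤ 2 := by
  by_contra! h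
  obtain ⟨i, j, l, hi, hj, hl, hij, hjl⟩ : ∃ i j l, (i < L ∧ G.Adj u (c i)) ∧
      (j < L ∧ G.Adj u (c j)) ∧ (l < L ∧ G.Adj u (c l)) ∧ i < j ∧ j < l := by
    obtain ⟨x, y, z, hx, hy, hz, hxy, hxz, hyz⟩ := Finset.two_lt_card_iff.mp h
    simp only [Finset.mem_filter, Finset.mem_range] at hx hy hz
    rcases lt_or_gt_of_ne hxy with h₁ | h₁ <;> rcases lt_or_gt_of_ne hxz with h₂ | h₂ <;>
      rcases lt_or_gt_of_ne hyz with h₃ | h₃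
    · exact ⟨x, y, z, hx, hy, hz, h₁, h₃⟩
    · exact ⟨x, z, y, hx, hz, hy, h₂, h₃⟩
    · omega
    · exact ⟨z, x, y, hz, hx, hy, h₂, h₁⟩
    · exact ⟨y, x, z, hy, hx, hz, h₁, h₂⟩
    · omega
    · exact ⟨y, z, x, hy, hz, hx, h₃, h₂⟩
    · exact ⟨z, y, x, hz, hy, hx, h₃, h₁⟩
  obtain ⟨d, rfl⟩ := Nat.exists_eq_add_of_lt hij
  obtain ⟨e, rfl⟩ := Nat.exists_eq_add_of_lt hjl
  have h1 := hc.common_neighbor (d := d + 1) hi.2 hj.2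
  have h2 := hc.common_neighbor (d := e + 1) hj.2 hl.2
  have h3 := hc.common_neighbor (i := i) (d := d + 1 + (e + 1)) hi.2
    (by simpa only [add_assoc] using hl.2)
  obtain ⟨m, hm⟩ := hc.odd
  simp only [Nat.even_iff, Nat.odd_iff] at h1 h2 h3
  omega

/-- The terms of the tour at distance two from a fixed vertex are close to each other. -/
lemma le_four_of_common_neighbor (hc : G.IsShortestOddTour L c) {i d : ℕ} {u v w : V}
    (hvu : G.Adj v u) (hu : G.Adj (c i) u) (hvw : G.Adj v w) (hw : G.Adj (c (i + d)) w)
    (hd : Even d) : d ≤ 4 ∨ 2 * L ≤ d + 4 := by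
  let p : G.Walk (c i) (c (i + d)) :=
    .cons hu (.cons hvu.symm (.cons hvw (.cons hw.symm .nil)))
  have hp : p.length = 4 := rfl
  have := hc.le_length_or_two_mul_le p (by rw [hp]; grind)
  rwa [hp] at this

lemma exists_forall_not_common_neighbor (hc : G.IsShortestOddTour L c) {k : ℕ} (hk : 2 ≤ k)
    (hL : 2 * k + 3 ≤ L) (v : V) :
    ∃ a, ∀ t < k, ∀ u, G.Adj v u → ¬ G.Adj (c (a + 4 * t)) u := by
  by_cases hbad : ∃ y u, G.Adj v u ∧ G.Adj (c y) u
  · obtain ⟨y, u, hvu, hu⟩ := hbad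
    by_cases hy : ∃ u', G.Adj v u' ∧ G.Adj (c (y + 4)) u'
    · obtain ⟨u', hvu', hu'⟩ := hy
      refine ⟨y + 6, fun t ht w hvw hw ↦ ?_⟩
      have h1 := hc.le_four_of_common_neighbor (i := y) (d := 6 + 4 * t) hvu hu hvw
        (by simpa only [add_assoc] using hw) (by grind)
      have h2 := hc.le_four_of_common_neighbor (i := y + 4) (d := 2 + 4 * t) hvu' hu' hvw
        (by rwa [show y + 4 + (2 + 4 * t) = y + 6 + 4 * t by omega]) (by grind)
      omega
    · push Not at hy
      refine ⟨y + 4, fun t ht w hvw hw ↦ ?_⟩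
      rcases Nat.eq_zero_or_pos t with rfl | hpos
      · exact hy w hvw hw
      have h1 := hc.le_four_of_common_neighbor (i := y) (d := 4 + 4 * t) hvu hu hvw
        (by simpa only [add_assoc] using hw) (by grind)
      omega
  · push Not at hbad
    exact ⟨0, fun t _ u hu ↦ hbad _ u hu⟩

lemma neighborFinset_disjoint [Fintype V] [DecidableRel G.Adj] (hc : G.IsShortestOddTour L c)
    {k : ℕ} (hL : 2 * k + 3 ≤ L) (a : ℕ) {s t : ℕ} (hst : s < t) (ht : t < k) :
    Disjoint (G.neighborFinset (c (a + 4 * s))) (G.neighborFinset (c (a + 4 * t))) := by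
  rw [Finset.disjoint_left]
  intro u hu hu'
  rw [mem_neighborFinset] at hu hu'
  have h := hc.common_neighbor (i := a + 4 * s) (d := 4 * (t - s)) hu.symm
    (by rw [show a + 4 * s + 4 * (t - s) = a + 4 * t by omega]; exact hu'.symm)
  simp only [Nat.even_iff, Nat.odd_iff] at h
  omega

theorem degree_add_mul_minDegree_lt_card [Fintype V] [DecidableRel G.Adj]
    (hc : G.IsShortestOddTour L c) {k : ℕ} (hk : 2 ≤ k) (hL : 2 * k + 3 ≤ L) (v : V) :
    k * G.minDegree + G.degree v < Fintype.card V := by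
  classical
  obtain ⟨a, ha⟩ := hc.exists_forall_not_common_neighbor hk hL v
  set B := (Finset.range k).biUnion fun t ↦ G.neighborFinset (c (a + 4 * t)) with hB
  have hcardB : k * G.minDegree ≤ B.card := by
    rw [hB, Finset.card_biUnion]
    · calc k * G.minDegree = ∑ _t ∈ Finset.range k, G.minDegree := by simp
        _ ≤ _ := Finset.sum_le_sum fun t _ ↦ by
          rw [card_neighborFinset_eq_degree]
          exact G.minDegree_le_degree _
    · intro s hs t ht hst
      rw [Finset.mem_coe, Finset.mem_range] at hs ht
      rcases Nat.lt_or_gt_of_ne hst with h | h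
      · exact hc.neighborFinset_disjoint hL a h ht
      · exact (hc.neighborFinset_disjoint hL a h hs).symm
  have hdisj : Disjoint B (G.neighborFinset v) := by
    rw [Finset.disjoint_left]
    intro u hu hvu
    simp only [hB, Finset.mem_biUnion, Finset.mem_range, mem_neighborFinset] at hu hvu
    obtain ⟨t, ht, hu⟩ := hu
    exact ha t ht u hvu hu
  obtain ⟨x, hx⟩ : ∃ x, x ∉ B ∪ G.neighborFinset v := by
    by_contra! hall
    let A : V → Finset ℕ := fun u ↦ (Finset.range L).filter fun i ↦ G.Adj u (c i)
    have hcover : Finset.range L ⊆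
        ((Finset.range k).biUnion fun t ↦ A (c (a + 4 * t))) ∪ A v := by
      intro i hi
      have := hall (c i)
      simp only [hB, Finset.mem_union, Finset.mem_biUnion, mem_neighborFinset] at this
      simp only [A, Finset.mem_union, Finset.mem_biUnion, Finset.mem_filter, hi, true_and]
      exact this
    have h1 := Finset.card_le_card hcover
    have h2 := Finset.card_union_le ((Finset.range k).biUnion fun t ↦ A (c (a + 4 * t))) (A v)
    have h3 := Finset.card_biUnion_le_card_mul (Finset.range k) (fun t ↦ A (c (a + 4 * t))) 2
      fun t _ ↦ hc.card_filter_adj_le_two (by omega) _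
    have h4 : (A v).card ≤ 2 := hc.card_filter_adj_le_two (by omega) v
    rw [Finset.card_range] at h1 h3
    omega
  have h := Finset.card_lt_univ_of_notMem hx
  rw [Finset.card_union_of_disjoint hdisj, card_neighborFinset_eq_degree] at h
  omega

end IsShortestOddTour

/-- A shortest odd closed walk is a cycle. -/
lemma Walk.isCycle_of_odd_of_forall_le {x : V} {w : G.Walk x x} (hw : Odd w.length)
    (hmin : ∀ (y : V) (w' : G.Walk y y), Odd w'.length → w.length ≤ w'.length) :
    w.IsCycle := by
  have hc := exists_isShortestOddTour hw hmin
  have hget : ∀ n ≤ w.length, w.getVert n = w.getVert (n % w.length) := by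
    intro n hn
    rcases hn.eq_or_lt with rfl | hn
    · simp
    · rw [Nat.mod_eq_of_lt hn]
  have hne : w.length ≠ 1 := by
    intro h
    have := w.adj_of_length_eq_one h
    exact G.irrefl this
  have hnil : ¬ w.Nil := fun h ↦ by
    rw [Walk.length_eq_zero_iff.mpr h] at hw
    simp at hw
  have hlen := Walk.length_tail_add_one hnil
  rw [Walk.isCycle_iff_isPath_tail_and_le_length]
  refine ⟨?_, by grind⟩
  rw [← Walk.IsPath.getVert_injOn_iff]
  have key : ∀ i j : ℕ, i ≤ j → j ≤ w.tail.length → w.tail.getVert i = w.tail.getVert j →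
      i = j := by
    intro i j hij hj h
    rw [Walk.getVert_tail, Walk.getVert_tail, hget (i + 1) (by omega),
      hget (j + 1) (by omega)] at h
    have := hc.eq_of_apply_eq (i := i + 1) (j := j + 1) (by omega) (by omega) h
    omega
  intro i hi j hj h
  rcases Nat.le_total i j with hij | hij
  · exact key i j hij hj h
  · exact (key j i hij hi h.symm).symm

lemma exists_odd_loop_forall_length_le (h : ¬ G.Colorable 2) :
    ∃ (x : V) (w : G.Walk x x), Odd w.length ∧
      ∀ (y : V) (w' : G.Walk y y), Odd w'.length → w.length ≤ w'.length := by
  classical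
  rw [two_colorable_iff_forall_loop_even] at h
  push Not at h
  obtain ⟨x, w, hw⟩ := h
  have hex : ∃ n, ∃ (x : V) (w : G.Walk x x), w.length = n ∧ Odd n :=
    ⟨_, x, w, rfl, Nat.not_even_iff_odd.mp hw⟩
  obtain ⟨y, p, hp, hodd⟩ := Nat.find_spec hex
  exact ⟨y, p, hp ▸ hodd, fun z q hq ↦ hp ▸ Nat.find_min' hex ⟨z, q, rfl, hq⟩⟩

end SimpleGraph

/-- Let `k ≥ 2`. If `G` is an `n`-vertex simple graph containing no odd cycle of length
at most `2k+1`, with `k·δ(G) + Δ(G) > n − 1`, then `G` is bipartite. -/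
theorem stmt_7 {V : Type*} [Fintype V] (k : ℕ) (hk : 2 ≤ k)
    (G : SimpleGraph V) [DecidableRel G.Adj]
    (hfree : ∀ (x : V) (c : G.Walk x x), c.IsCycle → Odd c.length → 2 * k + 1 < c.length)
    (hdeg : Fintype.card V < k * G.minDegree + G.maxDegree + 1) :
    G.Colorable 2 := by
  by_contra hcol
  obtain ⟨x, w, hw, hmin⟩ := SimpleGraph.exists_odd_loop_forall_length_le hcol
  have hlt := hfree x w (SimpleGraph.Walk.isCycle_of_odd_of_forall_le hw hmin) hw
  have : Nonempty V := ⟨x⟩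
  obtain ⟨v, hv⟩ := G.exists_maximal_degree_vertex
  obtain ⟨m, hm⟩ := hw
  have h := (SimpleGraph.exists_isShortestOddTour ⟨m, hm⟩ hmin).degree_add_mul_minDegree_lt_card
    hk (by omega) v
  omega
end

section
/- Suppose G is an n-vertex triangle-free (K_3-free) simple graph satisfying δ(G) > min{ n/2 − Δ(G)/4, n − Δ(G) − 1 }. Then G is bipartite. -/
namespace SimpleGraph

variable {V : Type*} {G : SimpleGraph V}

/-- A triangle-free graph has no three pairwise adjacent vertices. -/
theorem CliqueFree.not_adj_of_adj_of_adj (h : G.CliqueFree 3) {a b c : V}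
    (hab : G.Adj a b) (hac : G.Adj a c) : ¬ G.Adj b c := by
  classical
  exact fun hbc => h {a, b, c} (is3Clique_triple_iff.2 ⟨hab, hac, hbc⟩)

/-- A graph whose vertices split into two independent sets is 2-colorable. -/
theorem colorable_two_of_forall_adj (p : V → Prop)
    (h₁ : ∀ x y, G.Adj x y → p x → ¬ p y) (h₂ : ∀ x y, G.Adj x y → ¬ p x → p y) :
    G.Colorable 2 := by
  classical
  refine ⟨Coloring.mk (fun x => if p x then (0 : Fin 2) else 1) fun {x y} hxy => ?_⟩
  by_cases hx : p x
  · simp [hx, h₁ x y hxy hx]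
  · simp [hx, h₂ x y hxy hx]

variable [Fintype V] [DecidableRel G.Adj]

theorem degree_eq_sum_ite (x : V) : G.degree x = ∑ w, if G.Adj x w then 1 else 0 := by
  rw [← card_neighborFinset_eq_degree, neighborFinset_eq_filter, Finset.card_filter]

/-- In a triangle-free graph, the degrees along a closed walk of length five sum to at most
twice the number of vertices. -/
theorem CliqueFree.sum_degree_five_cycle_le (h : G.CliqueFree 3) {a b c d e : V}
    (hab : G.Adj a b) (hbc : G.Adj b c) (hcd : G.Adj c d) (hde : G.Adj d e) (hea : G.Adj e a) :
    G.degree a + G.degree b + G.degree c + G.degree d + G.degree e ≤ 2 * Fintype.card V := by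
  simp only [degree_eq_sum_ite, ← Finset.sum_add_distrib]
  calc _ ≤ ∑ _w : V, 2 := Finset.sum_le_sum fun w _ => ?_
    _ = 2 * Fintype.card V := by simp [mul_comm]
  have key : ∀ {x y : V}, G.Adj x y →
      (if G.Adj x w then 1 else 0) + (if G.Adj y w then 1 else 0) ≤ 1 := by
    intro x y hxy
    have := fun hx : G.Adj x w => h.not_adj_of_adj_of_adj hxy hx
    split_ifs <;> simp_all
  have := key hab
  have := key hbc
  have := key hcd
  have := key hde
  have := key hea
  omega

theorem CliqueFree.colorable_two_of_card_le_minDegree_add_maxDegree (h : G.CliqueFree 3)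
    (hdeg : Fintype.card V ≤ G.minDegree + G.maxDegree) : G.Colorable 2 := by
  classical
  cases isEmpty_or_nonempty V
  · exact .of_isEmpty 2
  obtain ⟨v, hv⟩ := G.exists_maximal_degree_vertex
  refine colorable_two_of_forall_adj (G.Adj v)
    (fun x y hxy hx hy => h.not_adj_of_adj_of_adj hx hy hxy) fun x y hxy hx => ?_
  by_contra hy
  have hpos : 0 < G.degree v := by
    rw [← hv]
    exact ((G.degree_pos_iff_exists_adj x).2 ⟨y, hxy⟩).trans_le (G.degree_le_maxDegree x)
  obtain ⟨u, hu⟩ := (G.degree_pos_iff_exists_adj v).1 hpos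
  have hsub : G.neighborFinset u ⊆ (G.neighborFinset v)ᶜ := by
    intro w hw
    simp only [mem_neighborFinset, Finset.mem_compl] at hw ⊢
    exact fun hvw => h.not_adj_of_adj_of_adj hu hvw hw
  have heq := Finset.eq_of_subset_of_card_le hsub (by
    rw [Finset.card_compl, card_neighborFinset_eq_degree, card_neighborFinset_eq_degree]
    have := G.minDegree_le_degree u
    omega)
  have hadj : ∀ w, ¬ G.Adj v w → G.Adj u w := fun w hw => by
    rw [← mem_neighborFinset, heq]
    simpa using hw
  exact h.not_adj_of_adj_of_adj (hadj x hx) (hadj y hy) hxy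

theorem CliqueFree.colorable_two_of_two_mul_card_lt (h : G.CliqueFree 3)
    (hdeg : 2 * Fintype.card V < 4 * G.minDegree + G.maxDegree) : G.Colorable 2 := by
  classical
  cases isEmpty_or_nonempty V
  · exact .of_isEmpty 2
  obtain ⟨v, hv⟩ := G.exists_maximal_degree_vertex
  refine colorable_two_of_forall_adj (fun x => ∃ a, G.Adj v a ∧ G.Adj a x) ?_ ?_
  · rintro b c hbc ⟨a, hva, hab⟩ ⟨d, hvd, hdc⟩
    have := h.sum_degree_five_cycle_le hva hab hbc hdc.symm hvd.symm
    have := G.minDegree_le_degree a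
    have := G.minDegree_le_degree b
    have := G.minDegree_le_degree c
    have := G.minDegree_le_degree d
    omega
  · intro x y hxy hx
    by_contra hy
    push Not at hx hy
    have hdisj : Disjoint (G.neighborFinset x) (G.neighborFinset y) := by
      rw [Finset.disjoint_left]
      intro w hw hw'
      rw [mem_neighborFinset] at hw hw'
      exact h.not_adj_of_adj_of_adj hxy hw hw'
    have hdisj' : Disjoint (G.neighborFinset x ∪ G.neighborFinset y) (G.neighborFinset v) := by
      rw [Finset.disjoint_left]
      intro w hw hvw
      simp only [Finset.mem_union, mem_neighborFinset] at hw hvw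
      exact hw.elim (fun hw => hx w hvw hw.symm) fun hw => hy w hvw hw.symm
    have hcard := Finset.card_le_univ
      (G.neighborFinset x ∪ G.neighborFinset y ∪ G.neighborFinset v)
    rw [Finset.card_union_of_disjoint hdisj', Finset.card_union_of_disjoint hdisj] at hcard
    simp only [card_neighborFinset_eq_degree] at hcard
    have := G.minDegree_le_degree x
    have := G.minDegree_le_degree y
    omega

end SimpleGraph

/-- If `G` is an `n`-vertex triangle-free simple graph with
`δ(G) > min{ n/2 − Δ(G)/4, n − Δ(G) − 1 }`, then `G` is bipartite. -/
theorem stmt_8 {V : Type*} [Fintype V]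
    (G : SimpleGraph V) [DecidableRel G.Adj]
    (hfree : G.CliqueFree 3)
    (hdeg : (G.minDegree : ℝ) >
      min ((Fintype.card V : ℝ) / 2 - (G.maxDegree : ℝ) / 4)
          ((Fintype.card V : ℝ) - (G.maxDegree : ℝ) - 1)) :
    G.Colorable 2 := by
  rcases min_lt_iff.1 hdeg with hlt | hlt
  · refine hfree.colorable_two_of_two_mul_card_lt ?_
    have : 2 * (Fintype.card V : ℝ) < 4 * G.minDegree + G.maxDegree := by linarith
    exact_mod_cast this
  · refine hfree.colorable_two_of_card_le_minDegree_add_maxDegree (Nat.lt_succ_iff.1 ?_)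
    have : (Fintype.card V : ℝ) < G.minDegree + G.maxDegree + 1 := by linarith
    exact_mod_cast this
end

section
/- Suppose G is an n-vertex triangle-free (K_3-free) simple graph with δ(G) + Δ(G) ≥ n. Then G is bipartite; moreover, for any edge {u,v} of G with deg(u) = Δ(G), the neighborhoods N(u) and N(v) partition the vertex set of G into two independent sets. -/
namespace SimpleGraph

variable {V : Type*} {G : SimpleGraph V} {u v : V}

theorem CliqueFree.disjoint_neighborSet (h : G.CliqueFree 3) (huv : G.Adj u v) :
    Disjoint (G.neighborSet u) (G.neighborSet v) := by
  classical
  rw [Set.disjoint_left]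
  intro w hu hv
  exact h {u, v, w} (is3Clique_triple_iff.mpr ⟨huv, hu, hv⟩)

theorem CliqueFree.neighborSet_union_eq_univ [Fintype V] [DecidableRel G.Adj]
    (h : G.CliqueFree 3) (huv : G.Adj u v)
    (hdeg : Fintype.card V ≤ G.degree u + G.degree v) :
    G.neighborSet u ∪ G.neighborSet v = Set.univ := by
  classical
  have hdisj : Disjoint (G.neighborFinset u) (G.neighborFinset v) := by
    rw [← Finset.disjoint_coe, coe_neighborFinset, coe_neighborFinset]
    exact h.disjoint_neighborSet huv
  have hcard : Fintype.card V ≤ (G.neighborFinset u ∪ G.neighborFinset v).card := by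
    rwa [Finset.card_union_of_disjoint hdisj, card_neighborFinset_eq_degree,
      card_neighborFinset_eq_degree]
  rw [← G.coe_neighborFinset u, ← G.coe_neighborFinset v, ← Finset.coe_union, Finset.coe_eq_univ,
    ← Finset.card_eq_iff_eq_univ]
  exact le_antisymm (Finset.card_le_univ _) hcard

theorem CliqueFree.isBipartiteWith_neighborSet (h : G.CliqueFree 3) (huv : G.Adj u v)
    (huniv : G.neighborSet u ∪ G.neighborSet v = Set.univ) :
    G.IsBipartiteWith (G.neighborSet u) (G.neighborSet v) where
  disjoint := h.disjoint_neighborSet huv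
  mem_of_adj a b hab := by
    have hu := G.isIndepSet_neighborSet_of_triangleFree h u
    have hv := G.isIndepSet_neighborSet_of_triangleFree h v
    have ha : a ∈ G.neighborSet u ∪ G.neighborSet v := huniv ▸ Set.mem_univ a
    have hb : b ∈ G.neighborSet u ∪ G.neighborSet v := huniv ▸ Set.mem_univ b
    rcases ha with ha | ha <;> rcases hb with hb | hb
    · exact absurd hab (hu ha hb hab.ne)
    · exact Or.inl ⟨ha, hb⟩
    · exact Or.inr ⟨ha, hb⟩
    · exact absurd hab (hv ha hb hab.ne)

end SimpleGraph

/-- If `G` is an `n`-vertex triangle-free simple graph with `δ(G) + Δ(G) ≥ n`, then `G`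
is bipartite; moreover, for every edge `{u, v}` of `G` with `deg(u) = Δ(G)`, the
neighborhoods `N(u)` and `N(v)` partition the vertex set into two independent sets. -/
theorem stmt_9 {V : Type*} [Fintype V]
    (G : SimpleGraph V) [DecidableRel G.Adj]
    (hfree : G.CliqueFree 3)
    (hdeg : Fintype.card V ≤ G.minDegree + G.maxDegree) :
    G.Colorable 2 ∧
      ∀ u v : V, G.Adj u v → G.degree u = G.maxDegree →
        G.neighborSet u ∪ G.neighborSet v = Set.univ ∧
        Disjoint (G.neighborSet u) (G.neighborSet v) ∧
        (G.neighborSet u).Pairwise (fun a b => ¬ G.Adj a b) ∧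
        (G.neighborSet v).Pairwise (fun a b => ¬ G.Adj a b) := by
  have huniv : ∀ u v : V, G.Adj u v → G.degree u = G.maxDegree →
      G.neighborSet u ∪ G.neighborSet v = Set.univ := fun u v huv hu ↦
    hfree.neighborSet_union_eq_univ huv (by have := G.minDegree_le_degree v; omega)
  refine ⟨?_, fun u v huv hu ↦ ⟨huniv u v huv hu, hfree.disjoint_neighborSet huv,
    G.isIndepSet_neighborSet_of_triangleFree hfree u,
    G.isIndepSet_neighborSet_of_triangleFree hfree v⟩⟩
  cases isEmpty_or_nonempty V
  · exact SimpleGraph.Colorable.of_isEmpty 2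
  · obtain ⟨u, hu⟩ := G.exists_maximal_degree_vertex
    have hpos : 0 < G.degree u := by
      have := G.minDegree_le_degree u
      have := Fintype.card_pos (α := V)
      omega
    obtain ⟨v, huv⟩ := (G.degree_pos_iff_exists_adj u).mp hpos
    exact (hfree.isBipartiteWith_neighborSet huv (huniv u v huv hu.symm)).isBipartite
end

section
/- Let k ≥ 2 and m ≥ k+1 be integers, and let G be an n-vertex C_{≤2k+1}-free simple graph whose shortest odd cycle has length 2m+1. If some cycle of length 2m+1 in G contains a vertex of degree Δ(G), then 1 + Δ(G) + (m-1)·δ(G) ≤ n; in particular, δ(G) ≤ (n − 1 − Δ(G))/k. -/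
namespace SimpleGraph.Walk

variable {V : Type*} {G : SimpleGraph V}

lemma exists_walk_getVert_getVert {u v : V} (p : G.Walk u v) {i j : ℕ} (hij : i ≤ j)
    (hj : j ≤ p.length) : ∃ q : G.Walk (p.getVert i) (p.getVert j), q.length = j - i := by
  refine ⟨((p.drop i).take (j - i)).copy rfl ?_, ?_⟩
  · rw [drop_getVert]
    congr 1
    omega
  · rw [length_copy, take_length, drop_length]
    omega

/-- A closed walk of odd length is at least as long as some odd cycle. -/
lemma exists_isCycle_odd_length_le {u : V} (w : G.Walk u u) (hw : Odd w.length) :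
    ∃ (x : V) (c : G.Walk x x), c.IsCycle ∧ Odd c.length ∧ c.length ≤ w.length := by
  induction hn : w.length using Nat.strong_induction_on generalizing u w with
  | _ n ih =>
  subst hn
  cases w with
  | nil => simp at hw
  | @cons _ v _ h p =>
  rw [length_cons] at hw
  by_cases hp : p.IsPath
  · refine ⟨u, cons h p, (cons_isCycle_iff p h).2 ⟨hp, fun he => ?_⟩, by simpa using hw, le_rfl⟩
    have hu : u = p.snd := hp.eq_snd_of_mem_edges (Sym2.eq_swap ▸ he)
    have hpos : p.length ≠ 0 := fun h0 => h.ne (eq_of_length_eq_zero h0).symm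
    have h1 : 1 = p.length := hp.getVert_injOn (by simp; omega) (by simp)
      (by rw [getVert_length]; exact hu.symm)
    rw [← h1] at hw
    exact absurd hw (by decide)
  · rw [← IsPath.getVert_injOn_iff] at hp
    obtain ⟨i, j, hij, hj, he⟩ :
        ∃ i j, i < j ∧ j ≤ p.length ∧ p.getVert i = p.getVert j := by
      by_contra! hcon
      refine hp fun i hi j hj he => ?_
      rcases lt_trichotomy i j with hlt | heq | hlt
      · exact absurd he (hcon i j hlt hj)
      · exact heq
      · exact absurd he.symm (hcon j i hlt hi)
    obtain ⟨q, hq⟩ := p.exists_walk_getVert_getVert hij.le hj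
    rcases Nat.even_or_odd (j - i) with hpar | hpar
    · let r : G.Walk u u := cons h ((p.take i).append ((p.drop j).copy he.symm rfl))
      have hr : r.length + (j - i) = p.length + 1 := by
        simp only [r, length_cons, length_append, length_copy, take_length, drop_length]
        omega
      have hro : Odd r.length := by
        rw [← hr] at hw
        exact (Nat.odd_add.1 hw).2 hpar
      obtain ⟨x, c, hc, hco, hcl⟩ := ih r.length (by rw [length_cons h p]; omega) r hro rfl
      exact ⟨x, c, hc, hco, by rw [length_cons]; omega⟩
    · obtain ⟨x, c, hc, hco, hcl⟩ := ih (j - i) (by rw [length_cons]; omega)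
        (q.copy rfl he.symm) (by rwa [length_copy, hq]) (by rw [length_copy, hq])
      exact ⟨x, c, hc, hco, by rw [length_cons]; omega⟩

/-- If every odd closed walk has length at least `2m+1`, then a walk between two vertices of a
closed walk of length `2m+1`, at positions `i < j`, is no shorter than the arc of its parity. -/
lemma le_length_of_closed_walk {m : ℕ}
    (hodd : ∀ (x : V) (w : G.Walk x x), Odd w.length → 2 * m + 1 ≤ w.length)
    {v : V} (c : G.Walk v v) (hc : c.length = 2 * m + 1) {i j : ℕ} (hij : i < j)
    (hj : j ≤ 2 * m) (q : G.Walk (c.getVert i) (c.getVert j)) :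
    (q.length % 2 = (j - i) % 2 ∧ j - i ≤ q.length) ∨
      (q.length % 2 ≠ (j - i) % 2 ∧ 2 * m + 1 - (j - i) ≤ q.length) := by
  obtain ⟨a, ha⟩ := c.exists_walk_getVert_getVert hij.le (by omega)
  have h1 := hodd _ (q.append a.reverse)
  have h2 := hodd _ ((q.append (c.drop j)).append (c.take i))
  simp only [length_append, length_reverse, take_length, drop_length, ha, hc, Nat.odd_iff] at h1 h2
  omega

end SimpleGraph.Walk

namespace SimpleGraph

variable {V : Type*} [Fintype V] (G : SimpleGraph V) [DecidableRel G.Adj]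

/-- If every odd closed walk has length at least `2m+1`, a closed walk of length `2m+1` starting
at `v` yields a vertex together with `m` disjoint neighborhoods, one of them that of `v`,
avoiding it. -/
theorem one_add_degree_add_mul_minDegree_le_card {m : ℕ} (hm : 3 ≤ m)
    (hodd : ∀ (x : V) (w : G.Walk x x), Odd w.length → 2 * m + 1 ≤ w.length)
    {v : V} (c : G.Walk v v) (hc : c.length = 2 * m + 1) :
    1 + G.degree v + (m - 1) * G.minDegree ≤ Fintype.card V := by
  classical
  have common : ∀ i j, i < j → j ≤ 2 * m → ∀ x, G.Adj (c.getVert i) x → G.Adj (c.getVert j) x →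
      j - i = 2 ∨ j - i = 2 * m - 1 := by
    intro i j hij hj x hi hj'
    have := c.le_length_of_closed_walk hodd hc hij hj (.cons hi (.cons hj'.symm .nil))
    simp only [Walk.length_cons, Walk.length_nil] at this
    omega
  have chord : ∀ i j, i < j → j ≤ 2 * m → G.Adj (c.getVert i) (c.getVert j) →
      j - i = 1 ∨ j - i = 2 * m := by
    intro i j hij hj h
    have := c.le_length_of_closed_walk hodd hc hij hj (.cons h .nil)
    simp only [Walk.length_cons, Walk.length_nil] at this
    omega
  obtain ⟨g, hg⟩ : ∃ g : ℕ → ℕ, ∀ t < m, g t ≤ 2 * m ∧ (g t = 4 * t ∨ g t + (2 * m + 1) = 4 * t) :=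
    ⟨fun t => if 4 * t ≤ 2 * m then 4 * t else 4 * t - (2 * m + 1), fun t ht => by
      dsimp only
      split_ifs <;> omega⟩
  let f : ℕ → V := fun t => c.getVert (g t)
  have hdisj : Set.PairwiseDisjoint (Finset.range m : Set ℕ) fun t => G.neighborFinset (f t) := by
    intro s hs t ht hst
    simp only [Finset.coe_range, Set.mem_Iio] at hs ht
    have hgs := hg s hs
    have hgt := hg t ht
    refine Finset.disjoint_left.2 fun x hx hy => ?_
    rw [mem_neighborFinset] at hx hy
    rcases lt_trichotomy (g s) (g t) with h | h | h
    · have := common _ _ h (by omega) x hx hy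
      omega
    · omega
    · have := common _ _ h (by omega) x hy hx
      omega
  have hout : c.getVert (2 * m - 2) ∉
      (Finset.range m).biUnion fun t => G.neighborFinset (f t) := by
    simp only [Finset.mem_biUnion, Finset.mem_range, mem_neighborFinset, not_exists, not_and]
    intro t ht hadj
    have hgt := hg t ht
    rcases lt_trichotomy (g t) (2 * m - 2) with h | h | h
    · have := chord _ _ h (by omega) hadj
      omega
    · simp only [f, h] at hadj
      exact G.irrefl hadj
    · have := chord _ _ h (by omega) hadj.symm
      omega
  have hcard := Finset.card_le_univ
    (insert (c.getVert (2 * m - 2)) ((Finset.range m).biUnion fun t => G.neighborFinset (f t)))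
  rw [Finset.card_insert_of_notMem hout, Finset.card_biUnion hdisj] at hcard
  obtain ⟨l, rfl⟩ : ∃ l, m = l + 1 := ⟨m - 1, by omega⟩
  simp only [card_neighborFinset_eq_degree, Finset.sum_range_succ'] at hcard
  have hsum : l * G.minDegree ≤ ∑ t ∈ Finset.range l, G.degree (f (t + 1)) := by
    simpa using Finset.card_nsmul_le_sum (Finset.range l) (fun t => G.degree (f (t + 1)))
      G.minDegree fun t _ => G.minDegree_le_degree _
  have hg0 : g 0 = 0 := by
    have := hg 0 (by omega)
    omega
  have h0 : f 0 = v := by simp [f, hg0]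
  rw [h0] at hcard
  simp only [Nat.add_sub_cancel]
  omega

end SimpleGraph


/-- Let `k ≥ 2` and `m ≥ k+1`, and let `G` be an `n`-vertex simple graph with no odd
cycle of length at most `2k+1`, whose shortest odd cycle has length `2m+1`. If some
cycle of length `2m+1` in `G` contains a vertex of degree `Δ(G)`, then
`1 + Δ(G) + (m-1)·δ(G) ≤ n`; in particular, `δ(G) ≤ (n − 1 − Δ(G))/k`. -/
theorem stmt_15 {V : Type*} [Fintype V] (k m : ℕ) (hk : 2 ≤ k) (hm : k + 1 ≤ m)
    (G : SimpleGraph V) [DecidableRel G.Adj]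
    (hfree : ∀ (x : V) (c : G.Walk x x), c.IsCycle → Odd c.length → 2 * k + 1 < c.length)
    (hgirth : ∀ (x : V) (c : G.Walk x x), c.IsCycle → Odd c.length → 2 * m + 1 ≤ c.length)
    (hcyc : ∃ (x : V) (c : G.Walk x x), c.IsCycle ∧ c.length = 2 * m + 1 ∧
      ∃ y ∈ c.support, G.degree y = G.maxDegree) :
    1 + G.maxDegree + (m - 1) * G.minDegree ≤ Fintype.card V ∧
      (G.minDegree : ℝ) ≤
        ((Fintype.card V : ℝ) - 1 - (G.maxDegree : ℝ)) / (k : ℝ) := by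
  classical
  have hodd : ∀ (x : V) (w : G.Walk x x), Odd w.length → 2 * m + 1 ≤ w.length := by
    intro x w hw
    obtain ⟨y, c, hc, hco, hcl⟩ := w.exists_isCycle_odd_length_le hw
    exact (hgirth y c hc hco).trans hcl
  obtain ⟨x, c, -, hlen, y, hy, hdeg⟩ := hcyc
  have hmain := G.one_add_degree_add_mul_minDegree_le_card (by omega) hodd (c.rotate y hy)
    (by rw [SimpleGraph.Walk.length_rotate, hlen])
  rw [hdeg] at hmain
  refine ⟨hmain, ?_⟩
  have hle : 1 + G.maxDegree + k * G.minDegree ≤ Fintype.card V :=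
    (Nat.add_le_add_left (Nat.mul_le_mul_right _ (by omega)) _).trans hmain
  have hle' : (1 + G.maxDegree + k * G.minDegree : ℝ) ≤ Fintype.card V := by exact_mod_cast hle
  rw [le_div_iff₀ (by positivity)]
  linarith
end

section
/- Let k ≥ 2 and m ≥ k+1 be integers, and let G be an n-vertex C_{≤2k+1}-free simple graph whose shortest odd cycle has length 2m+1. If no cycle of length 2m+1 in G contains a vertex of degree Δ(G), then Δ(G) + m·δ(G) ≤ n. -/
namespace SimpleGraph

variable {V : Type*} {G : SimpleGraph V}

/-- A closed walk of odd length that is not a cycle can be shortened to an odd cycle. -/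
theorem Walk.exists_isCycle_odd_length_lt {x : V} (w : G.Walk x x) (hodd : Odd w.length)
    (hw : ¬ w.IsCycle) :
    ∃ (y : V) (c : G.Walk y y), c.IsCycle ∧ Odd c.length ∧ c.length < w.length := by
  induction hn : w.length using Nat.strong_induction_on generalizing x with
  | _ n ih =>
    subst hn
    have shorten : ∀ (y : V) (p : G.Walk y y), Odd p.length → p.length < w.length →
        ∃ (z : V) (c : G.Walk z z), c.IsCycle ∧ Odd c.length ∧ c.length < w.length := by
      intro y p hp hlt
      by_cases hc : p.IsCycle
      · exact ⟨y, p, hc, hp, hlt⟩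
      · obtain ⟨z, c, h₁, h₂, h₃⟩ := ih _ hlt p hp hc rfl
        exact ⟨z, c, h₁, h₂, h₃.trans hlt⟩
    have h1 : w.length ≠ 1 := fun h ↦ G.loopless.irrefl x (Walk.adj_of_length_eq_one h)
    have h3 : 3 ≤ w.length := by
      obtain ⟨r, hr⟩ := hodd
      omega
    have hnil : ¬ w.Nil := by
      rw [← Walk.length_eq_zero_iff]
      omega
    have hlen : w.tail.length + 1 = w.length := Walk.length_tail_add_one hnil
    have hinj : ∃ a b, a < b ∧ 1 ≤ a ∧ b ≤ w.length ∧ w.getVert a = w.getVert b := by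
      by_contra! hcon
      refine hw (Walk.isCycle_iff_isPath_tail_and_le_length.mpr ⟨?_, h3⟩)
      rw [← Walk.IsPath.getVert_injOn_iff]
      intro a ha b hb hab
      simp only [Set.mem_ofPred_eq] at ha hb
      rw [Walk.getVert_tail, Walk.getVert_tail] at hab
      rcases lt_trichotomy a b with h | h | h
      · exact absurd hab (hcon _ _ (by omega) (by omega) (by omega))
      · exact h
      · exact absurd hab.symm (hcon _ _ (by omega) (by omega) (by omega))
    obtain ⟨a, b, hab, ha, hb, heq⟩ := hinj
    by_cases hp : Odd (b - a)
    · have hend : (w.drop a).getVert (b - a) = w.getVert a := by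
        rw [Walk.drop_getVert, heq]
        congr 1
        omega
      refine shorten _ (((w.drop a).take (b - a)).copy rfl hend) ?_ ?_
      · simpa [Walk.take_length, Walk.drop_length, Nat.min_eq_left (show b - a ≤ w.length - a by omega)]
      · simp [Walk.take_length, Walk.drop_length]
        omega
    · have hl : (((w.take a).copy rfl heq).append (w.drop b)).length = w.length - (b - a) := by
        simp [Walk.take_length, Walk.drop_length]
        omega
      refine shorten _ (((w.take a).copy rfl heq).append (w.drop b)) ?_ ?_
      · rw [hl]
        rw [Nat.not_odd_iff_even] at hp
        exact Nat.Odd.sub_even (by omega) hodd hp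
      · rw [hl]
        omega

/-- If `2 * m + 1` bounds the length of odd cycles from below, then a closed odd walk of at most
that length is a cycle of that length. -/
theorem Walk.isCycle_and_length_eq_of_odd {m : ℕ}
    (hgirth : ∀ (x : V) (c : G.Walk x x), c.IsCycle → Odd c.length → 2 * m + 1 ≤ c.length)
    {x : V} (w : G.Walk x x) (hodd : Odd w.length) (hle : w.length ≤ 2 * m + 1) :
    w.IsCycle ∧ w.length = 2 * m + 1 := by
  by_cases hc : w.IsCycle
  · exact ⟨hc, le_antisymm hle (hgirth x w hc hodd)⟩
  · obtain ⟨y, c, h₁, h₂, h₃⟩ := w.exists_isCycle_odd_length_lt hodd hc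
    have := hgirth y c h₁ h₂
    omega

theorem exists_walk_length_eq_of_adj_succ {f : ℕ → V} (hf : ∀ i, G.Adj (f i) (f (i + 1)))
    (i l : ℕ) : ∃ p : G.Walk (f i) (f (i + l)), p.length = l := by
  induction l with
  | zero => exact ⟨Walk.nil, rfl⟩
  | succ l ih =>
    obtain ⟨p, hp⟩ := ih
    exact ⟨p.concat (hf (i + l)), by simp [hp]⟩

/-- A closed walk, traversed periodically. -/
theorem Walk.exists_periodic_adj_succ {x : V} (c : G.Walk x x) (hpos : 0 < c.length) :
    ∃ f : ℕ → V, (∀ i, G.Adj (f i) (f (i + 1))) ∧ ∀ i, f (i + c.length) = f i := by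
  refine ⟨fun i ↦ c.getVert (i % c.length), fun i ↦ ?_, fun i ↦ by simp⟩
  have hlt := Nat.mod_lt i hpos
  have hadj := c.adj_getVert_succ hlt
  rcases Nat.lt_or_ge (i % c.length + 1) c.length with h | h
  · have : (i + 1) % c.length = i % c.length + 1 := by
      rw [Nat.add_mod, ← Nat.mod_eq_of_lt h]
      simp
    simpa only [this] using hadj
  · have h0 : i % c.length + 1 = c.length := by omega
    have : (i + 1) % c.length = 0 := by
      rw [← Nat.mod_add_mod, h0, Nat.mod_self]
    rw [h0, Walk.getVert_length] at hadj
    simpa only [this, Walk.getVert_zero] using hadj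

/-- On a closed walk of length `2 * m + 1`, an even step `d` with `4 ≤ d ≤ 4 * m - 2` amounts to an
odd step of length at most `2 * m - 3`. -/
theorem exists_odd_complement {m d : ℕ} (hd : Even d) (h4 : 4 ≤ d) (hdm : d + 2 ≤ 4 * m) :
    ∃ l, Odd l ∧ l + 4 ≤ 2 * m + 1 ∧ (d + l = 2 * m + 1 ∨ d = l + (2 * m + 1)) := by
  obtain ⟨e, rfl⟩ := hd
  rcases Nat.lt_or_ge (e + e) (2 * m + 1) with h | h
  · exact ⟨2 * m + 1 - (e + e), ⟨m - e, by omega⟩, by omega, Or.inl (by omega)⟩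
  · exact ⟨e + e - (2 * m + 1), ⟨e - m - 1, by omega⟩, by omega, Or.inr (by omega)⟩

/-- Let `f` run around an odd closed walk of length `2 * m + 1`, and let `H` be a set of positions
without two members joined by an odd stretch of length at most `2 * m - 3`. Then some translate of
`{4, 8, …, 4 * m}` avoids `H`. -/
theorem exists_shift_avoiding {m : ℕ} (hm : 3 ≤ m) {H : ℕ → Prop}
    (hper : ∀ i, H (i + (2 * m + 1)) ↔ H i)
    (hodd : ∀ i l, H i → H (i + l) → Odd l → ¬ l + 4 ≤ 2 * m + 1) :
    ∃ i, ∀ j, 1 ≤ j → j ≤ m → ¬ H (i + 4 * j) := by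
  have key : ∀ i d, H i → H (i + d) → Even d → 4 ≤ d → d + 2 ≤ 4 * m → False := by
    intro i d hi hid hd h4 hdm
    obtain ⟨l, hl, hlm, h | h⟩ := exists_odd_complement hd h4 hdm
    · refine hodd (i + d) l hid ?_ hl hlm
      rwa [add_assoc, h, hper]
    · refine hodd i l hi ?_ hl hlm
      rwa [h, ← add_assoc, hper] at hid
  by_cases hne : ∃ a, H a
  · obtain ⟨a, ha⟩ := hne
    by_cases h2 : H (a + 2)
    · refine ⟨a, fun j h1 hj hH ↦ ?_⟩
      rcases Nat.lt_or_ge j m with hlt | hge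
      · exact key a (4 * j) ha hH ⟨2 * j, by ring⟩ (by omega) (by omega)
      · obtain rfl : j = m := by omega
        refine key (a + 2) (4 * j - 2) h2 ?_ ⟨2 * j - 1, by omega⟩ (by omega) (by omega)
        rwa [show a + 2 + (4 * j - 2) = a + 4 * j by omega]
    · refine ⟨a + (2 * m + 1) - 2, fun j h1 hj hH ↦ ?_⟩
      rw [show a + (2 * m + 1) - 2 + 4 * j = a + (4 * j - 2) + (2 * m + 1) by omega, hper] at hH
      rcases Nat.lt_or_ge 1 j with hlt | hge
      · exact key a (4 * j - 2) ha hH ⟨2 * j - 1, by omega⟩ (by omega) (by omega)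
      · obtain rfl : j = 1 := by omega
        exact h2 hH
  · exact ⟨0, fun j _ _ hH ↦ hne ⟨_, hH⟩⟩

end SimpleGraph


/-- Let `k ≥ 2` and `m ≥ k+1`, and let `G` be an `n`-vertex simple graph with no odd
cycle of length at most `2k+1`, whose shortest odd cycle has length `2m+1`. If no cycle
of length `2m+1` in `G` contains a vertex of degree `Δ(G)`, then `Δ(G) + m·δ(G) ≤ n`. -/
theorem stmt_16 {V : Type*} [Fintype V] (k m : ℕ) (hk : 2 ≤ k) (hm : k + 1 ≤ m)
    (G : SimpleGraph V) [DecidableRel G.Adj]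
    (hfree : ∀ (x : V) (c : G.Walk x x), c.IsCycle → Odd c.length → 2 * k + 1 < c.length)
    (hex : ∃ (x : V) (c : G.Walk x x), c.IsCycle ∧ c.length = 2 * m + 1)
    (hgirth : ∀ (x : V) (c : G.Walk x x), c.IsCycle → Odd c.length → 2 * m + 1 ≤ c.length)
    (hnomax : ∀ (x : V) (c : G.Walk x x), c.IsCycle → c.length = 2 * m + 1 →
      ∀ y ∈ c.support, G.degree y ≠ G.maxDegree) :
    G.maxDegree + m * G.minDegree ≤ Fintype.card V := by
  classical
  obtain ⟨x, c, hc, hlen⟩ := hex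
  obtain ⟨f, hf, hper⟩ := c.exists_periodic_adj_succ (by omega)
  rw [hlen] at hper
  have : Nonempty V := ⟨x⟩
  obtain ⟨v, hv⟩ := G.exists_maximal_degree_vertex
  obtain ⟨i, hi⟩ := SimpleGraph.exists_shift_avoiding (m := m) (by omega)
    (H := fun i ↦ ∃ w, G.Adj v w ∧ G.Adj w (f i)) (fun i ↦ by rw [hper]) (by
      rintro i l ⟨w, hvw, hw⟩ ⟨w', hvw', hw'⟩ hl hlm
      obtain ⟨p, hp⟩ := SimpleGraph.exists_walk_length_eq_of_adj_succ hf i l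
      let q : G.Walk v v := .cons hvw (.cons hw (p.append (.cons hw'.symm (.cons hvw'.symm .nil))))
      have hq : q.length = l + 4 := by simp [q, hp]
      obtain ⟨hqc, hql⟩ := q.isCycle_and_length_eq_of_odd hgirth
        (by rw [hq]; exact hl.add_even (by decide)) (by omega)
      exact hnomax v q hqc hql v q.start_mem_support hv.symm)
  have hcommon : ∀ i l w, G.Adj (f i) w → G.Adj (f (i + l)) w → Odd l → ¬ l + 4 ≤ 2 * m + 1 := by
    intro i l w hw hw' hl hlm
    obtain ⟨p, hp⟩ := SimpleGraph.exists_walk_length_eq_of_adj_succ hf i l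
    let q : G.Walk w w := .cons hw.symm (p.append (.cons hw' .nil))
    have hq : q.length = l + 2 := by simp [q, hp]
    obtain ⟨-, hql⟩ := q.isCycle_and_length_eq_of_odd hgirth
      (by rw [hq]; exact hl.add_even (by decide)) (by omega)
    omega
  have hdisj : ∀ a b w, a < b → 1 ≤ a → b ≤ m →
      G.Adj (f (i + 4 * a)) w → ¬ G.Adj (f (i + 4 * b)) w := by
    intro a b w hab ha hb hwa hwb
    have hb' : i + 4 * b = i + 4 * a + 4 * (b - a) := by omega
    obtain ⟨l, hl, hlm, h | h⟩ := SimpleGraph.exists_odd_complement (m := m) (d := 4 * (b - a))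
      ⟨2 * (b - a), by ring⟩ (by omega) (by omega)
    · refine hcommon (i + 4 * b) l w hwb ?_ hl hlm
      rwa [hb', add_assoc, h, hper]
    · refine hcommon (i + 4 * a) l w hwa ?_ hl hlm
      rwa [hb', h, ← add_assoc, hper] at hwb
  let U := (Finset.Icc 1 m).biUnion fun j ↦ G.neighborFinset (f (i + 4 * j))
  have hU : m * G.minDegree ≤ U.card := by
    rw [Finset.card_biUnion]
    · calc m * G.minDegree = ∑ _j ∈ Finset.Icc 1 m, G.minDegree := by simp
        _ ≤ _ := Finset.sum_le_sum fun j _ ↦ by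
          rw [SimpleGraph.card_neighborFinset_eq_degree]
          exact G.minDegree_le_degree _
    · intro a ha b hb hab
      rw [Finset.mem_coe, Finset.mem_Icc] at ha hb
      refine Finset.disjoint_left.mpr fun w hwa hwb ↦ ?_
      rw [SimpleGraph.mem_neighborFinset] at hwa hwb
      rcases lt_or_gt_of_ne hab with h | h
      · exact hdisj a b w h ha.1 hb.2 hwa hwb
      · exact hdisj b a w h hb.1 ha.2 hwb hwa
  have hvU : Disjoint (G.neighborFinset v) U := by
    refine Finset.disjoint_left.mpr fun w hvw hwU ↦ ?_
    obtain ⟨j, hj, hjw⟩ := Finset.mem_biUnion.mp hwU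
    rw [Finset.mem_Icc] at hj
    rw [SimpleGraph.mem_neighborFinset] at hvw hjw
    exact hi j hj.1 hj.2 ⟨w, hvw, hjw.symm⟩
  calc G.maxDegree + m * G.minDegree ≤ (G.neighborFinset v).card + U.card := by
        rw [hv, SimpleGraph.card_neighborFinset_eq_degree]
        omega
    _ = (G.neighborFinset v ∪ U).card := (Finset.card_union_of_disjoint hvU).symm
    _ ≤ Fintype.card V := Finset.card_le_univ _
end

section
/- Let G be a simple graph whose shortest odd cycle has length 2m+1 with m ≥ 3, let C = v_0 v_1 ⋯ v_{2m} be a cycle of length 2m+1 in G, and suppose that no cycle of length 2m+1 in G contains a vertex of degree Δ(G). If u is a vertex of degree Δ(G), then there exists an index i ∈ {0, 1, …, 2m} such that N(u) ∩ (N(v_0) ∪ N(v_1) ∪ ⋯ ∪ N(v_{2m})) ⊆ N(v_i) ∪ N(v_{i+2}), where indices are taken modulo 2m+1. -/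
namespace SimpleGraph

variable {V : Type*} {G : SimpleGraph V}

/-- An odd closed walk that is not a cycle can be shortened to another odd closed walk. -/
theorem Walk.exists_odd_length_lt_of_not_isCycle {x : V} (c : G.Walk x x) (hodd : Odd c.length)
    (hc : ¬ c.IsCycle) : ∃ (y : V) (d : G.Walk y y), Odd d.length ∧ d.length < c.length := by
  cases c with
  | nil => simp at hodd
  | @cons _ z _ h p =>
    have hlen : 3 ≤ (cons h p).length := by
      have h2 : p.length ≠ 0 := fun h0 => h.ne (eq_of_length_eq_zero h0).symm
      rw [length_cons] at hodd ⊢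
      obtain ⟨k, hk⟩ := hodd
      omega
    have hp : ¬ p.IsPath := fun hp =>
      hc (isCycle_iff_isPath_tail_and_le_length.2 ⟨by simpa using hp, hlen⟩)
    rw [isPath_iff_isSubwalk_imp_nil] at hp
    push Not at hp
    obtain ⟨y, d, ⟨r, s, rfl⟩, hd⟩ := hp
    have hd0 : d.length ≠ 0 := fun h0 => hd (length_eq_zero_iff.1 h0)
    by_cases hdo : Odd d.length
    · exact ⟨y, d, hdo, by simp only [length_cons, length_append]; omega⟩
    · refine ⟨x, cons h (r.append s), ?_, by simp only [length_cons, length_append]; omega⟩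
      simp only [length_cons, length_append] at hodd ⊢
      grind

/-- Every odd closed walk is at least as long as some odd cycle. -/
theorem Walk.exists_isCycle_odd_length_le_s17 {x : V} (c : G.Walk x x) (hodd : Odd c.length) :
    ∃ (y : V) (d : G.Walk y y), d.IsCycle ∧ Odd d.length ∧ d.length ≤ c.length := by
  induction hn : c.length using Nat.strong_induction_on generalizing x with
  | _ n ih =>
    by_cases hc : c.IsCycle
    · exact ⟨x, c, hc, hodd, hn.le⟩
    · obtain ⟨y, d, hd, hlt⟩ := c.exists_odd_length_lt_of_not_isCycle hodd hc
      obtain ⟨z, e, he, heo, hle⟩ := ih d.length (hn ▸ hlt) d hd rfl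
      exact ⟨z, e, he, heo, by omega⟩

/-- An odd closed walk that is no longer than any odd cycle is itself a cycle. -/
theorem Walk.isCycle_of_odd_length_le {n : ℕ}
    (hgirth : ∀ (x : V) (c : G.Walk x x), c.IsCycle → Odd c.length → n ≤ c.length)
    {x : V} (c : G.Walk x x) (hodd : Odd c.length) (hle : c.length ≤ n) : c.IsCycle := by
  by_contra hc
  obtain ⟨y, d, hd, hlt⟩ := c.exists_odd_length_lt_of_not_isCycle hodd hc
  obtain ⟨z, e, he, heo, hle'⟩ := d.exists_isCycle_odd_length_le_s17 hd
  have := hgirth z e he heo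
  omega

theorem exists_walk_length_eq_of_adj_add_one {R : Type*} [AddMonoidWithOne R] {v : R → V}
    (hadj : ∀ i, G.Adj (v i) (v (i + 1))) (i : R) (n : ℕ) :
    ∃ p : G.Walk (v i) (v (i + n)), p.length = n := by
  induction n with
  | zero => exact ⟨Walk.nil.copy rfl (by simp), by simp⟩
  | succ n ih =>
    obtain ⟨p, hp⟩ := ih
    exact ⟨(p.concat (hadj _)).copy rfl (by rw [Nat.cast_succ, add_assoc]), by simp [hp]⟩

end SimpleGraph

/-- Differences in `{0, 2, -2}` confine a set of residues modulo `n ≥ 7` to some `{i, i + 2}`. -/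
theorem ZMod.exists_subset_pair_add_two {n : ℕ} (hn : 7 ≤ n) (J : Set (ZMod n))
    (hJ : ∀ i ∈ J, ∀ j ∈ J, j = i ∨ j = i + 2 ∨ i = j + 2) :
    ∃ i, ∀ j ∈ J, j = i ∨ j = i + 2 := by
  have hne : ∀ k : ℕ, 0 < k → k < 7 → (k : ZMod n) ≠ 0 := fun k h0 h7 h => by
    have := Nat.le_of_dvd h0 ((ZMod.natCast_eq_zero_iff k n).1 h)
    omega
  have h2 : (2 : ZMod n) ≠ 0 := by exact_mod_cast hne 2 (by norm_num) (by norm_num)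
  have h6 : (6 : ZMod n) ≠ 0 := by exact_mod_cast hne 6 (by norm_num) (by norm_num)
  by_cases h : ∃ i ∈ J, i + 2 ∈ J
  · obtain ⟨i, hi, hi2⟩ := h
    refine ⟨i, fun j hj => ?_⟩
    rcases hJ i hi j hj with h | h | h
    · exact Or.inl h
    · exact Or.inr h
    · rcases hJ _ hi2 j hj with h' | h' | h'
      · exact Or.inr h'
      · exact absurd (by linear_combination -h - h') h6
      · exact absurd (by linear_combination h' - h) h2
  · push Not at h
    rcases J.eq_empty_or_nonempty with rfl | ⟨i, hi⟩
    · exact ⟨0, by simp⟩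
    · refine ⟨i, fun j hj => ?_⟩
      rcases hJ i hi j hj with h' | h' | h'
      · exact Or.inl h'
      · exact Or.inr h'
      · exact absurd (h' ▸ hi) (h j hj)

/-- Let `G` be a simple graph whose shortest odd cycle has length `2m+1` with `m ≥ 3`,
let `C = v₀ v₁ ⋯ v_{2m}` be a cycle of length `2m+1` in `G` (encoded as an injective map
`v : ZMod (2m+1) → V` with consecutive vertices adjacent), and suppose no cycle of length
`2m+1` in `G` contains a vertex of degree `Δ(G)`. If `u` has degree `Δ(G)`, then there is
an index `i` such that `N(u) ∩ (N(v₀) ∪ ⋯ ∪ N(v_{2m})) ⊆ N(v i) ∪ N(v (i+2))`, indices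
taken modulo `2m+1`. -/
theorem stmt_17 {V : Type*} [Fintype V] (m : ℕ) (hm : 3 ≤ m)
    (G : SimpleGraph V) [DecidableRel G.Adj]
    (hex : ∃ (x : V) (c : G.Walk x x), c.IsCycle ∧ c.length = 2 * m + 1)
    (hgirth : ∀ (x : V) (c : G.Walk x x), c.IsCycle → Odd c.length → 2 * m + 1 ≤ c.length)
    (v : ZMod (2 * m + 1) → V) (hinj : Function.Injective v)
    (hadj : ∀ i : ZMod (2 * m + 1), G.Adj (v i) (v (i + 1)))
    (hnomax : ∀ (x : V) (c : G.Walk x x), c.IsCycle → c.length = 2 * m + 1 →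
      ∀ y ∈ c.support, G.degree y ≠ G.maxDegree)
    (u : V) (hu : G.degree u = G.maxDegree) :
    ∃ i : ZMod (2 * m + 1),
      G.neighborSet u ∩ (⋃ j : ZMod (2 * m + 1), G.neighborSet (v j)) ⊆
        G.neighborSet (v i) ∪ G.neighborSet (v (i + 2)) := by
  have noWalk : ∀ c : G.Walk u u, Odd c.length → 2 * m + 1 < c.length := fun c hodd => by
    by_contra! hle
    have hc := c.isCycle_of_odd_length_le hgirth hodd hle
    exact hnomax u c hc (le_antisymm hle (hgirth u c hc hodd)) u c.start_mem_support hu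
  let J : Set (ZMod (2 * m + 1)) := {j | ∃ w, G.Adj u w ∧ G.Adj w (v j)}
  have arc : ∀ i ∈ J, ∀ j ∈ J, ∀ n : ℕ, j = i + n → Odd n → 2 * m + 1 < n + 4 := by
    rintro i ⟨w, huw, hwi⟩ _ ⟨w', huw', hwj⟩ n rfl hodd
    obtain ⟨p, hp⟩ := SimpleGraph.exists_walk_length_eq_of_adj_add_one hadj i n
    have := noWalk (.cons huw (.cons hwi ((p.concat hwj.symm).concat huw'.symm)))
      (by simp only [SimpleGraph.Walk.length_cons, SimpleGraph.Walk.length_concat, hp]; grind)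
    simp only [SimpleGraph.Walk.length_cons, SimpleGraph.Walk.length_concat, hp] at this
    omega
  have hJ : ∀ i ∈ J, ∀ j ∈ J, j = i ∨ j = i + 2 ∨ i = j + 2 := by
    intro i hi j hj
    obtain ⟨d, hd, hdlt⟩ : ∃ d : ℕ, j = i + d ∧ d < 2 * m + 1 :=
      ⟨(j - i).val, by simp, ZMod.val_lt _⟩
    have hback : i = j + (2 * m + 1 - d : ℕ) := by
      rw [hd, add_assoc, ← Nat.cast_add, Nat.add_sub_cancel' hdlt.le, ZMod.natCast_self, add_zero]
    rcases Nat.even_or_odd d with he | ho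
    · have := arc j hj i hi _ hback (by grind)
      obtain rfl | rfl : d = 0 ∨ d = 2 := by grind
      · simp [hd]
      · simp [hd]
    · have := arc i hi j hj d hd ho
      have h2 : 2 * m + 1 - d = 2 := by grind
      rw [h2] at hback
      exact Or.inr (Or.inr (by exact_mod_cast hback))
  obtain ⟨i, hi⟩ := ZMod.exists_subset_pair_add_two (by omega) J hJ
  refine ⟨i, fun w ⟨huw, hw⟩ => ?_⟩
  obtain ⟨j, hj⟩ := Set.mem_iUnion.1 hw
  rcases hi j ⟨w, huw, SimpleGraph.Adj.symm hj⟩ with rfl | rfl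
  · exact Or.inl hj
  · exact Or.inr hj
end
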